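/- There exists an infinite word over the alphabet {0,1,3,4} containing no additive cube: there is a function f : ℕ → ℕ with f(n) ∈ {0,1,3,4} for all n, such that for all i ∈ ℕ and all n ≥ 1, it is NOT the case that ∑_{j<n} f(i+j) = ∑_{j<n} f(i+n+j) and ∑_{j<n} f(i+n+j) = ∑_{j<n} f(i+2n+j). -/

import Mathlib

namespace AddCube

/-- Binary search trees with natural number keys. -/
inductive T where
  | e : T
  | n : T → ℕ → T → T

namespace T
def s (k : ℕ) : T := n e k e
end T

/-- If-then-else, written with the recursor. -/
noncomputable def sel (c x y : Bool) : Bool := Bool.rec (motive := fun _ => Bool) y x c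

theorem sel_eq (c x y : Bool) : sel c x y = bif c then x else y := by cases c <;> rfl

noncomputable def mem (t : T) (x : ℕ) : Bool :=
  T.rec (motive := fun _ => Bool) false
    (fun _ k _ il ir => sel (Nat.blt x k) il (sel (Nat.blt k x) ir true)) t

noncomputable def allT (p : ℕ → Bool) (t : T) : Bool :=
  T.rec (motive := fun _ => Bool) true
    (fun _ k _ il ir => sel (p k) (sel il ir false) false) t

theorem mem_n (l r : T) (k x : ℕ) : mem (T.n l k r) x =
    bif Nat.blt x k then mem l x else bif Nat.blt k x then mem r x else true := by
  change sel (Nat.blt x k) (mem l x) (sel (Nat.blt k x) (mem r x) true) = _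
  simp only [sel_eq]

theorem allT_n (p : ℕ → Bool) (l r : T) (k : ℕ) : allT p (T.n l k r) =
    (p k && (allT p l && allT p r)) := by
  change sel (p k) (sel (allT p l) (allT p r) false) false = _
  simp only [sel_eq]
  cases p k <;> cases allT p l <;> rfl

theorem allT_mem {p : ℕ → Bool} {t : T} {x : ℕ} (h : allT p t = true) (hx : mem t x = true) :
    p x = true := by
  induction t with
  | e => exact absurd hx Bool.false_ne_true
  | n l k r ihl ihr =>
    simp only [allT_n, Bool.and_eq_true] at h
    rw [mem_n] at hx
    rcases lt_trichotomy x k with h1 | h1 | h1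
    · have : Nat.blt x k = true := by simpa [Nat.blt_eq] using h1
      rw [this] at hx
      exact ihl h.2.1 hx
    · subst h1
      exact h.1
    · have h2 : Nat.blt x k = false := by
        rw [← Bool.not_eq_true, Nat.blt_eq]; omega
      have h3 : Nat.blt k x = true := by simpa [Nat.blt_eq] using h1
      rw [h2, h3] at hx
      exact ihr h.2.2 hx

section
open T
set_option maxRecDepth 20000 in
def treeS : T :=
  n (n (n (n (n (n (n (n (n (n (s 379349) 379381 (s 379382)) 379413 (n (s 380372) 380403 e))
  380404 (n (n (s 380405) 380434 (s 380435)) 380436 (n (s 380437) 380438 e))) 380467 (n (n (n (s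
  381460) 381461 (s 381462)) 381492 (n (s 410069) 410101 e)) 410102 (n (n (s 410132) 411061 e)
  411092 (n (s 411093) 411123 e)))) 411124 (n (n (n (n (s 411125) 411126 (s 411156)) 411157 (n (s
  412084) 412085 e)) 412115 (n (n (s 412116) 412117 e) 412146 (n (s 412147) 412148 e))) 412149 (n
  (n (n (s 412150) 412177 (s 412178)) 412179 (n (s 412180) 412181 e)) 412210 (n (n (s 412211)
  413107 e) 413108 (n (s 413109) 413138 e))))) 413139 (n (n (n (n (n (s 413140) 413141 (s
  413169)) 413170 (n (s 413171) 413172 e)) 413173 (n (n (s 413174) 413201 (s 413202)) 413203 (n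
  (s 413204) 413205 e))) 413206 (n (n (n (s 413233) 413234 (s 413235)) 413236 (n (s 413265)
  413266 e)) 413297 (n (n (s 414100) 414131 e) 414132 (n (s 414162) 414163 e)))) 414164 (n (n (n
  (n (s 414165) 414194 (s 414195)) 414196 (n (s 414197) 414198 e)) 414226 (n (n (s 414227) 414228
  e) 414229 (n (s 414258) 414259 e))) 414260 (n (n (n (s 414290) 415220 (s 415221)) 415252 (n (s
  415253) 438805 e)) 440820 (n (n (s 441812) 441813 e) 441845 (n (s 441846) 441876 e)))))) 442804
  (n (n (n (n (n (n (s 442805) 442835 (s 442836)) 442837 (n (s 442866) 442867 e)) 442868 (n (n (s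
  442869) 442870 (s 442899)) 442900 (n (s 442901) 443827 e))) 443828 (n (n (n (s 443829) 443858
  (s 443859)) 443860 (n (s 443861) 443889 e)) 443890 (n (n (s 443891) 443892 e) 443893 (n (s
  443894) 443920 e)))) 443921 (n (n (n (n (s 443922) 443923 (s 443924)) 443925 (n (s 443952)
  443953 e)) 443954 (n (n (s 443955) 443984 e) 443985 (n (s 444820) 444821 e))) 444851 (n (n (n
  (s 444852) 444853 (s 444882)) 444883 (n (s 444884) 444885 e)) 444886 (n (n (s 444913) 444914 e)
  444915 (n (s 444916) 444917 e))))) 444918 (n (n (n (n (n (s 444944) 444945 (s 444946)) 444947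
  (n (s 444948) 444949 e)) 444975 (n (n (s 444976) 444977 (s 444978)) 444979 (n (s 445007) 445008
  e))) 445009 (n (n (n (s 445010) 445039 (s 445041)) 445844 (n (s 445845) 445874 e)) 445875 (n (n
  (s 445876) 445877 e) 445905 (n (s 445906) 445907 e)))) 445908 (n (n (n (n (s 445909) 445910 (s
  445936)) 445937 (n (s 445938) 445939 e)) 445940 (n (n (s 445941) 445942 e) 445967 (n (s 445968)
  445969 e))) 445970 (n (n (n (s 445971) 445972 (s 445973)) 446000 (n (s 446001) 446002 e))
  446003 (n (n (s 446032) 446033 e) 446034 (n (s 446064) 446868 e))))))) 446869 (n (n (n (n (n (n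
  (n (s 446898) 446899 (s 446900)) 446901 (n (s 446928) 446929 e)) 446930 (n (n (s 446931) 446932
  (s 446933)) 446934 (n (s 446960) 446961 e))) 446962 (n (n (n (s 446963) 446964 (s 446965))
  446993 (n (s 446994) 446995 e)) 446996 (n (n (s 447025) 447026 e) 447027 (n (s 447057) 447058
  e)))) 447892 (n (n (n (n (s 447893) 447921 (s 447922)) 447923 (n (s 447924) 447925 e)) 447953
  (n (n (s 447954) 447955 e) 447956 (n (s 447957) 447958 e))) 447985 (n (n (n (s 447986) 447987
  (s 447988)) 447989 (n (s 448018) 448019 e)) 448020 (n (n (s 448050) 448851 e) 448947 (n (s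
  448948) 448949 e))))) 448978 (n (n (n (n (n (s 448979) 448980 (s 448981)) 449011 (n (s 449012)
  449043 e)) 449781 (n (n (s 472564) 473556 (s 473587)) 473588 (n (s 473589) 473619 e))) 473620
  (n (n (n (s 474548) 474579 (s 474580)) 474581 (n (s 474610) 474611 e)) 474612 (n (n (s 474613)
  474641 e) 474642 (n (s 474643) 474644 e)))) 474645 (n (n (n (n (s 474673) 474674 (s 475540))
  475571 (n (s 475572) 475602 e)) 475603 (n (n (s 475604) 475605 e) 475633 (n (s 475634) 475635
  e))) 475636 (n (n (n (s 475637) 475638 (s 475664)) 475665 (n (s 475666) 475667 e)) 475668 (n (n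
  (s 475669) 475695 e) 475696 (n (s 475697) 475698 e)))))) 475699 (n (n (n (n (n (n (s 475727)
  475728 (s 475729)) 476564 (n (s 476594) 476595 e)) 476596 (n (n (s 476597) 476625 (s 476626))
  476627 (n (s 476628) 476629 e))) 476656 (n (n (n (s 476657) 476658 (s 476659)) 476660 (n (s
  476661) 476662 e)) 476687 (n (n (s 476688) 476689 e) 476690 (n (s 476691) 476692 e)))) 476693
  (n (n (n (n (s 476718) 476719 (s 476720)) 476721 (n (s 476722) 476723 e)) 476749 (n (n (s
  476750) 476751 e) 476752 (n (s 476753) 476782 e))) 476783 (n (n (n (s 477587) 477588 (s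
  477589)) 477618 (n (s 477619) 477620 e)) 477621 (n (n (s 477648) 477649 e) 477650 (n (s 477651)
  477652 e))))) 477653 (n (n (n (n (n (s 477654) 477679 (s 477680)) 477681 (n (s 477682) 477683
  e)) 477684 (n (n (s 477685) 477686 (s 477710)) 477711 (n (s 477712) 477713 e))) 477714 (n (n (n
  (s 477715) 477716 (s 477742)) 477743 (n (s 477744) 477745 e)) 477746 (n (n (s 477747) 477774 e)
  477775 (n (s 477776) 477777 e)))) 477807 (n (n (n (n (s 477808) 477839 (s 478611)) 478612 (n (s
  478613) 478642 e)) 478643 (n (n (s 478644) 478645 e) 478646 (n (s 478672) 478673 e))) 478674 (n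
  (n (n (s 478675) 478676 (s 478677)) 478678 (n (s 478703) 478704 e)) 478705 (n (n (s 478706)
  478707 e) 478708 (n (s 478709) 478734 e)))))))) 478735 (n (n (n (n (n (n (n (n (s 478736)
  478737 (s 478738)) 478739 (n (s 478740) 478767 e)) 478768 (n (n (s 478769) 478770 (s 478799))
  478800 (n (s 478801) 478831 e))) 478832 (n (n (n (s 479634) 479636 (s 479637)) 479666 (n (s
  479667) 479668 e)) 479669 (n (n (s 479670) 479696 e) 479697 (n (s 479698) 479699 e)))) 479700
  (n (n (n (n (s 479701) 479727 (s 479728)) 479729 (n (s 479730) 479731 e)) 479732 (n (n (s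
  479759) 479760 e) 479761 (n (s 479762) 479763 e))) 479792 (n (n (n (s 479793) 479794 (s
  479824)) 479825 (n (s 480564) 480690 e)) 480691 (n (n (s 480693) 480720 e) 480721 (n (s 480722)
  480723 e))))) 480724 (n (n (n (n (n (s 480752) 480753 (s 480754)) 480755 (n (s 480784) 480785
  e)) 480786 (n (n (s 480817) 481745 (s 481777)) 481778 (n (s 481809) 504339 e))) 504370 (n (n (n
  (s 505299) 505330 (s 505331)) 505332 (n (s 505362) 505363 e)) 505364 (n (n (s 506291) 506322 e)
  506323 (n (s 506324) 506353 e)))) 506354 (n (n (n (n (s 506355) 506356 (s 506384)) 506385 (n (s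
  506386) 506387 e)) 506388 (n (n (s 506389) 506416 e) 506417 (n (s 506418) 507314 e))) 507315 (n
  (n (n (s 507316) 507345 (s 507346)) 507347 (n (s 507348) 507376 e)) 507377 (n (n (s 507378)
  507379 e) 507380 (n (s 507381) 507407 e)))))) 507408 (n (n (n (n (n (n (s 507409) 507410 (s
  507411)) 507412 (n (s 507413) 507438 e)) 507439 (n (n (s 507440) 507441 (s 507442)) 507443 (n
  (s 507470) 507471 e))) 507472 (n (n (n (s 507473) 507502 (s 508307)) 508308 (n (s 508338)
  508339 e)) 508340 (n (n (s 508368) 508369 e) 508370 (n (s 508371) 508372 e)))) 508373 (n (n (n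
  (n (s 508399) 508400 (s 508401)) 508402 (n (s 508403) 508404 e)) 508405 (n (n (s 508430) 508431
  e) 508432 (n (s 508433) 508434 e))) 508435 (n (n (n (s 508436) 508461 (s 508462)) 508463 (n (s
  508464) 508465 e)) 508466 (n (n (s 508467) 508492 e) 508493 (n (s 508494) 508495 e))))) 508496
  (n (n (n (n (n (s 508497) 508524 (s 508525)) 508526 (n (s 508527) 508557 e)) 509331 (n (n (s
  509332) 509361 (s 509362)) 509363 (n (s 509364) 509365 e))) 509392 (n (n (n (s 509393) 509394
  (s 509395)) 509396 (n (s 509397) 509423 e)) 509424 (n (n (s 509425) 509426 e) 509427 (n (s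
  509428) 509429 e)))) 509453 (n (n (n (n (s 509454) 509455 (s 509456)) 509457 (n (s 509458)
  509459 e)) 509460 (n (n (s 509484) 509485 e) 509486 (n (s 509487) 509488 e))) 509489 (n (n (n
  (s 509490) 509517 (s 509518)) 509519 (n (s 509520) 509521 e)) 509549 (n (n (s 509550) 509551 e)
  509581 (n (s 509582) 510355 e))))))) 510356 (n (n (n (n (n (n (n (s 510357) 510385 (s 510386))
  510387 (n (s 510388) 510389 e)) 510416 (n (n (s 510417) 510418 (s 510419)) 510420 (n (s 510421)
  510446 e))) 510447 (n (n (n (s 510448) 510449 (s 510450)) 510451 (n (s 510452) 510477 e))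
  510478 (n (n (s 510479) 510480 e) 510481 (n (s 510482) 510483 e)))) 510509 (n (n (n (n (s
  510510) 510511 (s 510512)) 510513 (n (s 510514) 510542 e)) 510543 (n (n (s 510544) 510545 e)
  510574 (n (s 510575) 510606 e))) 511347 (n (n (n (s 511380) 511410 (s 511411)) 511412 (n (s
  511413) 511440 e)) 511441 (n (n (s 511442) 511443 e) 511444 (n (s 511470) 511471 e))))) 511472
  (n (n (n (n (n (s 511473) 511474 (s 511475)) 511501 (n (s 511502) 511503 e)) 511504 (n (n (s
  511505) 511506 (s 511534)) 511535 (n (s 511536) 511537 e))) 511566 (n (n (n (s 511567) 511568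
  (s 511599)) 512277 (n (s 512464) 512465 e)) 512466 (n (n (s 512494) 512495 e) 512496 (n (s
  512497) 512498 e)))) 512526 (n (n (n (n (s 512527) 512528 (s 512529)) 512559 (n (s 512560)
  512591 e)) 513519 (n (n (s 513520) 513551 e) 513552 (n (s 536114) 537042 e))) 537073 (n (n (n
  (s 537074) 537105 (s 537106)) 537107 (n (s 537137) 537138 e)) 538034 (n (n (s 538065) 538066 e)
  538096 (n (s 538097) 538098 e)))))) 538099 (n (n (n (n (n (n (s 538127) 538128 (s 538129))
  538130 (n (s 538131) 538159 e)) 538160 (n (n (s 538161) 538162 (s 538191)) 538192 (n (s 539058)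
  539059 e))) 539089 (n (n (n (s 539090) 539091 (s 539119)) 539120 (n (s 539121) 539122 e))
  539123 (n (n (s 539150) 539151 e) 539152 (n (s 539153) 539154 e)))) 539155 (n (n (n (n (s
  539156) 539181 (s 539182)) 539183 (n (s 539184) 539185 e)) 539186 (n (n (s 539213) 539214 e)
  539215 (n (s 539216) 539217 e))) 539245 (n (n (n (s 539246) 539340 (s 540051)) 540081 (n (s
  540082) 540083 e)) 540112 (n (n (s 540113) 540114 e) 540115 (n (s 540116) 540143 e))))) 540144
  (n (n (n (n (n (s 540145) 540146 (s 540147)) 540148 (n (s 540174) 540175 e)) 540176 (n (n (s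
  540177) 540178 (s 540179)) 540180 (n (s 540205) 540206 e))) 540207 (n (n (n (s 540208) 540209
  (s 540210)) 540236 (n (s 540237) 540238 e)) 540239 (n (n (s 540240) 540241 e) 540268 (n (s
  540269) 540270 e)))) 540271 (n (n (n (n (s 540300) 540301 (s 541075)) 541076 (n (s 541105)
  541106 e)) 541107 (n (n (s 541108) 541135 e) 541136 (n (s 541137) 541138 e))) 541139 (n (n (n
  (s 541140) 541166 (s 541167)) 541168 (n (s 541169) 541170 e)) 541171 (n (n (s 541172) 541197 e)
  541198 (n (s 541199) 541200 e))))))))) 541201 (n (n (n (n (n (n (n (n (n (s 541202) 541203 (s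
  541228)) 541229 (n (s 541230) 541231 e)) 541232 (n (n (s 541233) 541234 (s 541260)) 541261 (n
  (s 541262) 541263 e))) 541264 (n (n (n (s 541265) 541292 (s 541293)) 541294 (n (s 541295)
  541324 e)) 541325 (n (n (s 542099) 542100 e) 542129 (n (s 542130) 542131 e)))) 542132 (n (n (n
  (n (s 542159) 542160 (s 542161)) 542162 (n (s 542163) 542164 e)) 542190 (n (n (s 542191) 542192
  e) 542193 (n (s 542194) 542195 e))) 542220 (n (n (n (s 542221) 542222 (s 542223)) 542224 (n (s
  542225) 542226 e)) 542252 (n (n (s 542253) 542254 e) 542255 (n (s 542256) 542257 e))))) 542284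
  (n (n (n (n (n (s 542285) 542286 (s 542287)) 542288 (n (s 542317) 542318 e)) 542319 (n (n (s
  542349) 543060 (s 543154)) 543155 (n (s 543183) 543184 e))) 543185 (n (n (n (s 543186) 543187
  (s 543214)) 543215 (n (s 543216) 543217 e)) 543218 (n (n (s 543219) 543244 e) 543245 (n (s
  543246) 543247 e)))) 543248 (n (n (n (n (s 543249) 543277 (s 543278)) 543279 (n (s 543280)
  543281 e)) 543309 (n (n (s 543310) 543311 e) 543341 (n (s 543342) 544208 e))) 544209 (n (n (n
  (s 544238) 544239 (s 544240)) 544241 (n (s 544269) 544270 e)) 544271 (n (n (s 544272) 544273 e)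
  544301 (n (s 544302) 544303 e)))))) 544304 (n (n (n (n (n (n (s 544334) 544335 (s 544366))
  545262 (n (s 545263) 545293 e)) 545294 (n (n (s 545295) 545326 (s 545327)) 545358 (n (s 568848)
  568849 e))) 568880 (n (n (n (s 568881) 568882 (s 569809)) 569840 (n (s 569841) 569871 e))
  569872 (n (n (s 569873) 569874 e) 569902 (n (s 569903) 569904 e)))) 569905 (n (n (n (n (s
  569906) 569934 (s 569935)) 569936 (n (s 570123) 570801 e)) 570832 (n (n (s 570833) 570834 e)
  570863 (n (s 570864) 570865 e))) 570866 (n (n (n (s 570894) 570895 (s 570896)) 570897 (n (s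
  570898) 570899 e)) 570925 (n (n (s 570926) 570927 e) 570928 (n (s 570929) 570930 e))))) 570956
  (n (n (n (n (n (s 570957) 570958 (s 570959)) 570960 (n (s 570987) 570988 e)) 570989 (n (n (s
  570990) 571020 (s 571053)) 571794 (n (s 571825) 571826 e))) 571855 (n (n (n (s 571856) 571857
  (s 571858)) 571886 (n (s 571887) 571888 e)) 571889 (n (n (s 571890) 571891 e) 571917 (n (s
  571918) 571919 e)))) 571920 (n (n (n (n (s 571921) 571922 (s 571923)) 571948 (n (s 571949)
  571950 e)) 571951 (n (n (s 571952) 571953 e) 571954 (n (s 571979) 571980 e))) 571981 (n (n (n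
  (s 571982) 571983 (s 571984)) 572011 (n (s 572012) 572013 e)) 572014 (n (n (s 572015) 572043 e)
  572044 (n (s 572045) 572818 e))))))) 572819 (n (n (n (n (n (n (n (s 572849) 572850 (s 572851))
  572879 (n (s 572880) 572881 e)) 572882 (n (n (s 572883) 572910 (s 572911)) 572912 (n (s 572913)
  572914 e))) 572915 (n (n (n (s 572916) 572940 (s 572941)) 572942 (n (s 572943) 572944 e))
  572945 (n (n (s 572946) 572947 e) 572971 (n (s 572972) 572973 e)))) 572974 (n (n (n (n (s
  572975) 572976 (s 572977)) 573003 (n (s 573004) 573005 e)) 573006 (n (n (s 573007) 573008 e)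
  573035 (n (s 573036) 573037 e))) 573038 (n (n (n (s 573039) 573068 (s 573069)) 573843 (n (s
  573873) 573874 e)) 573875 (n (n (s 573876) 573903 e) 573904 (n (s 573905) 573906 e))))) 573907
  (n (n (n (n (n (s 573908) 573933 (s 573934)) 573935 (n (s 573936) 573937 e)) 573938 (n (n (s
  573939) 573964 (s 573965)) 573966 (n (s 573967) 573968 e))) 573969 (n (n (n (s 573970) 573995
  (s 573996)) 573997 (n (s 573998) 573999 e)) 574000 (n (n (s 574001) 574027 e) 574028 (n (s
  574029) 574030 e)))) 574031 (n (n (n (n (s 574032) 574060 (s 574061)) 574062 (n (s 574092)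
  574093 e)) 574898 (n (n (s 574927) 574928 e) 574929 (n (s 574930) 574957 e))) 574958 (n (n (n
  (s 574959) 574960 (s 574961)) 574962 (n (s 574987) 574988 e)) 574989 (n (n (s 574990) 574991 e)
  574992 (n (s 574993) 575019 e)))))) 575020 (n (n (n (n (n (n (s 575021) 575022 (s 575023))
  575024 (n (s 575052) 575053 e)) 575054 (n (n (s 575055) 575084 (s 575085)) 575086 (n (s 575982)
  575983 e))) 575984 (n (n (n (s 576012) 576013 (s 576014)) 576015 (n (s 576016) 576044 e))
  576045 (n (n (s 576046) 576047 e) 576076 (n (s 576077) 576078 e)))) 576109 (n (n (n (n (s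
  577036) 577037 (s 577038)) 577068 (n (s 577069) 577070 e)) 577101 (n (n (s 578030) 578061 e)
  600591 (n (s 600622) 600623 e))) 600655 (n (n (n (s 601583) 601614 (s 601615)) 601616 (n (s
  601645) 601646 e)) 601647 (n (n (s 601648) 601676 e) 601677 (n (s 601678) 601679 e))))) 601680
  (n (n (n (n (n (s 601707) 601709 (s 601710)) 601836 (n (s 602575) 602576 e)) 602606 (n (n (s
  602607) 602608 (s 602637)) 602638 (n (s 602639) 602640 e))) 602641 (n (n (n (s 602668) 602669
  (s 602670)) 602671 (n (s 602672) 602673 e)) 602699 (n (n (s 602700) 602701 e) 602702 (n (s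
  602703) 602704 e)))) 602730 (n (n (n (n (s 602731) 602732 (s 602733)) 602734 (n (s 602763)
  602764 e)) 602766 (n (n (s 603568) 603569 e) 603599 (n (s 603600) 603601 e))) 603630 (n (n (n
  (s 603631) 603632 (s 603633)) 603660 (n (s 603661) 603662 e)) 603663 (n (n (s 603664) 603665 e)
  603666 (n (s 603691) 603692 e)))))))) 603693 (n (n (n (n (n (n (n (n (s 603694) 603695 (s
  603696)) 603697 (n (s 603722) 603723 e)) 603724 (n (n (s 603725) 603726 (s 603727)) 603728 (n
  (s 603754) 603755 e))) 603756 (n (n (n (s 603757) 603758 (s 603787)) 603788 (n (s 603789)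
  604592 e)) 604593 (n (n (s 604623) 604624 e) 604625 (n (s 604626) 604653 e)))) 604654 (n (n (n
  (n (s 604655) 604656 (s 604657)) 604658 (n (s 604684) 604685 e)) 604686 (n (n (s 604687) 604688
  e) 604689 (n (s 604690) 604714 e))) 604715 (n (n (n (s 604716) 604717 (s 604718)) 604719 (n (s
  604720) 604721 e)) 604746 (n (n (s 604747) 604748 e) 604749 (n (s 604750) 604751 e))))) 604779
  (n (n (n (n (n (s 604780) 604781 (s 604782)) 604811 (n (s 604812) 604813 e)) 605617 (n (n (s
  605618) 605647 (s 605648)) 605649 (n (s 605650) 605651 e))) 605677 (n (n (n (s 605678) 605679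
  (s 605680)) 605681 (n (s 605682) 605707 e)) 605708 (n (n (s 605709) 605710 e) 605711 (n (s
  605712) 605713 e)))) 605738 (n (n (n (n (s 605739) 605740 (s 605741)) 605742 (n (s 605743)
  605744 e)) 605771 (n (n (s 605772) 605773 e) 605774 (n (s 605775) 605803 e))) 605804 (n (n (n
  (s 605805) 605806 (s 605836)) 606671 (n (s 606672) 606673 e)) 606701 (n (n (s 606702) 606703 e)
  606704 (n (s 606705) 606731 e)))))) 606732 (n (n (n (n (n (n (s 606733) 606734 (s 606735))
  606736 (n (s 606762) 606763 e)) 606764 (n (n (s 606765) 606766 (s 606767)) 606795 (n (s 606796)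
  606797 e))) 606798 (n (n (n (s 606828) 606829 (s 606860)) 607726 (n (s 607727) 607755 e))
  607756 (n (n (s 607757) 607758 e) 607759 (n (s 607787) 607788 e)))) 607789 (n (n (n (n (s
  607790) 607819 (s 607820)) 607821 (n (s 607852) 608780 e)) 608781 (n (n (s 608811) 608812 e)
  608813 (n (s 608844) 609805 e))) 609836 (n (n (n (s 632619) 633357 (s 633388)) 633389 (n (s
  633419) 633420 e)) 633421 (n (n (s 633422) 633451 e) 633452 (n (s 633453) 633454 e))))) 633549
  (n (n (n (n (n (s 634350) 634380 (s 634381)) 634382 (n (s 634411) 634412 e)) 634413 (n (n (s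
  634414) 634415 (s 634442)) 634443 (n (s 634444) 634445 e))) 634446 (n (n (n (s 634447) 634475
  (s 634476)) 634477 (n (s 634478) 634479 e)) 634507 (n (n (s 634508) 635342 e) 635343 (n (s
  635373) 635374 e)))) 635375 (n (n (n (n (s 635404) 635405 (s 635406)) 635407 (n (s 635435)
  635436 e)) 635437 (n (n (s 635438) 635439 e) 635440 (n (s 635466) 635467 e))) 635468 (n (n (n
  (s 635469) 635470 (s 635471)) 635472 (n (s 635499) 635500 e)) 635501 (n (n (s 635502) 635531 e)
  635532 (n (s 636336) 636366 e))))))) 636367 (n (n (n (n (n (n (n (s 636368) 636397 (s 636398))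
  636399 (n (s 636400) 636427 e)) 636428 (n (n (s 636429) 636430 (s 636431)) 636432 (n (s 636433)
  636458 e))) 636459 (n (n (n (s 636460) 636461 (s 636462)) 636463 (n (s 636464) 636490 e))
  636491 (n (n (s 636492) 636493 e) 636494 (n (s 636495) 636523 e)))) 636524 (n (n (n (n (s
  636525) 636526 (s 636555)) 636556 (n (s 636587) 637359 e)) 637361 (n (n (s 637390) 637391 e)
  637392 (n (s 637393) 637421 e))) 637422 (n (n (n (s 637423) 637424 (s 637425)) 637451 (n (s
  637452) 637453 e)) 637454 (n (n (s 637455) 637456 e) 637482 (n (s 637483) 637484 e))))) 637485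
  (n (n (n (n (n (s 637486) 637487 (s 637514)) 637515 (n (s 637516) 637517 e)) 637518 (n (n (s
  637547) 637548 (s 637549)) 637579 (n (s 637580) 638415 e))) 638416 (n (n (n (s 638445) 638446
  (s 638447)) 638448 (n (s 638475) 638476 e)) 638477 (n (n (s 638478) 638479 e) 638480 (n (s
  638506) 638507 e)))) 638508 (n (n (n (n (s 638509) 638510 (s 638511)) 638539 (n (s 638540)
  638541 e)) 638542 (n (n (s 638571) 638572 e) 638573 (n (s 639499) 639500 e))) 639501 (n (n (n
  (s 639502) 639530 (s 639531)) 639532 (n (s 639533) 639534 e)) 639563 (n (n (s 639564) 639565 e)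
  639595 (n (s 639596) 640554 e)))))) 640555 (n (n (n (n (n (n (s 640556) 640587 (s 640588))
  641580 (n (s 643595) 667147 e)) 667148 (n (n (s 667179) 667180 (s 668110)) 668140 (n (s 668141)
  668142 e))) 668171 (n (n (n (s 668172) 668173 (s 668174)) 668202 (n (s 668203) 668204 e))
  668205 (n (n (s 668206) 668235 e) 668236 (n (s 668237) 668238 e)))) 668268 (n (n (n (n (s
  668269) 668300 (s 669134)) 669135 (n (s 669164) 669165 e)) 669166 (n (n (s 669167) 669194 e)
  669195 (n (s 669196) 669197 e))) 669198 (n (n (n (s 669199) 669226 (s 669227)) 669228 (n (s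
  669229) 669230 e)) 669231 (n (n (s 669259) 669260 e) 669261 (n (s 669262) 669291 e))))) 669292
  (n (n (n (n (n (s 669293) 670189 (s 670190)) 670191 (n (s 670219) 670220 e)) 670221 (n (n (s
  670222) 670223 (s 670250)) 670251 (n (s 670252) 670253 e))) 670254 (n (n (n (s 670283) 670284
  (s 670285)) 670315 (n (s 670316) 671243 e)) 671244 (n (n (s 671274) 671275 e) 671276 (n (s
  671277) 671307 e)))) 671308 (n (n (n (n (s 671339) 672268 (s 672298)) 672299 (n (s 672331)
  700877 e)) 700908 (n (n (s 700938) 700939 e) 700940 (n (s 701933) 701962 e))) 701963 (n (n (n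
  (s 701964) 701965 (s 701966)) 701995 (n (s 701996) 701997 e)) 702028 (n (n (s 702987) 703018 e)
  703019 (n (s 703051) 704043 e)))))))))
end

section
open T
set_option maxRecDepth 20000 in
def treeF : T :=
  n (n (n (n (n (n (n (n (n (n (n (s 506416) 507408 e) 507440 (n (s 507473) 508400 e)) 508432 (n
  (n (s 508465) 508497 e) 540143 (n (s 540208) 541135 e))) 541167 (n (n (n (s 541168) 541200 e)
  541233 (n (s 541265) 542192 e)) 542257 (n (n (s 573903) 573935 e) 573968 (s 574000)))) 574927
  (n (n (n (n (s 574960) 574992 e) 575984 (n (s 1523249) 1554960 e)) 1554992 (n (n (s 1554993)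
  1555952 e) 1555984 (n (s 1555985) 1556017 e))) 1556049 (n (n (n (s 1556944) 1556976 e) 1556977
  (n (s 1557009) 1557041 e)) 1557042 (n (n (s 1588720) 1588752 e) 1588785 (s 1588817))))) 1589712
  (n (n (n (n (n (s 1589744) 1589745 e) 1589777 (n (s 1589809) 1590736 e)) 1590769 (n (n (s
  1590801) 1591793 e) 1622479 (n (s 1622480) 1622512 e))) 1622544 (n (n (n (s 1623504) 1623536 e)
  1623537 (n (s 1623569) 2603536 e)) 2603568 (n (n (s 2603569) 2604528 e) 2604561 (s 2604593))))
  2604625 (n (n (n (n (s 2636271) 2636304 e) 2636336 (n (s 2637295) 2637296 e)) 2637328 (n (n (s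
  2637361) 2637393 e) 2638288 (s 2638320))) 2638321 (n (n (n (s 2638353) 2638385 e) 2638386 (n (s
  2638417) 2639345 e)) 2670031 (n (n (s 2670063) 2670096 e) 2670128 (s 2671055)))))) 2671056 (n
  (n (n (n (n (n (s 2671088) 2671120 e) 2671121 (n (s 2671153) 2672080 e)) 2672112 (n (n (s
  2672113) 2672145 e) 2703823 (n (s 3620401) 3652112 e))) 3652144 (n (n (n (s 3653104) 3653136 e)
  3653169 (n (s 3653201) 3654096 e)) 3654128 (n (n (s 3654161) 3654193 e) 3654225 (s 3685871))))
  3685904 (n (n (n (n (s 3685936) 3686863 e) 3686896 (n (s 3686928) 3686961 e)) 3686993 (n (n (s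
  3687888) 3687920 e) 3687953 (s 3687985))) 3688945 (n (n (n (s 3688977) 3719631 e) 3720688 (n (s
  3721712) 4701711 e)) 4701742 (n (n (s 4701743) 4701775 e) 4701776 (s 4702768))))) 4702800 (n (n
  (n (n (n (s 4733454) 4734510 e) 4734511 (n (s 4734543) 4734575 e)) 4735502 (n (n (s 4735503)
  4735567 e) 4735568 (n (s 4736495) 4736559 e))) 4736560 (n (n (n (s 4768237) 4768238 e) 4768270
  (n (s 4768271) 4768302 e)) 4768303 (n (n (s 4768336) 4769262 e) 4769263 (s 4769294)))) 4769295
  (n (n (n (n (s 4769327) 4769359 e) 4770286 (n (s 4770287) 4770319 e)) 4770320 (n (n (s 4770351)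
  4802030 e) 4802063 (s 5749296))) 5750287 (n (n (n (s 5750288) 5750319 e) 5750320 (n (s 5750351)
  5750352 e)) 5750353 (n (n (s 5751312) 5751344 e) 5751345 (s 5751376))))))) 5751377 (n (n (n (n
  (n (n (n (s 5783023) 5783054 e) 5783055 (n (s 5783087) 5783088 e)) 5783119 (n (n (s 5783120)
  5784015 e) 5784046 (n (s 5784047) 5784079 e))) 5784080 (n (n (n (s 5784111) 5784112 e) 5784144
  (n (s 5784145) 5785039 e)) 5785072 (n (n (s 5785103) 5785104 e) 5785136 (s 5785137)))) 5785168
  (n (n (n (n (s 5816783) 5816814 e) 5816815 (n (s 5816846) 5816847 e)) 5816848 (n (n (s 5816880)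
  5816912 e) 5817807 (s 5817838))) 5817839 (n (n (n (s 5817871) 5817872 e) 5817903 (n (s 5817904)
  5818863 e)) 5818864 (n (n (s 5818895) 5818896 e) 5850607 (s 5850639))))) 6797872 (n (n (n (n (n
  (s 6798863) 6798864 e) 6798895 (n (s 6798896) 6798928 e)) 6798929 (n (n (s 6830606) 6830607 e)
  6830638 (n (s 6830639) 6830671 e))) 6830672 (n (n (n (s 6831599) 6831630 e) 6831631 (n (s
  6831663) 6831664 e)) 6831695 (n (n (s 6831696) 6832591 e) 6832623 (s 6832655)))) 6832656 (n (n
  (n (n (s 6832687) 6832688 e) 6832720 (n (s 6832721) 6833713 e)) 6864366 (n (n (s 6864398)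
  6864399 e) 6864430 (s 6864431))) 6864464 (n (n (n (s 6865359) 6865390 e) 6865391 (n (s 6865422)
  6865423 e)) 6865424 (n (n (s 6865455) 6865456 e) 6865487 (s 6865488)))))) 6866383 (n (n (n (n
  (n (n (s 6866415) 6866416 e) 6866447 (n (s 6866448) 6866479 e)) 6866480 (n (n (s 6867440)
  6867472 e) 6898158 (n (s 6898191) 6899182 e))) 6899183 (n (n (n (s 6899215) 7847439 e) 7847471
  (n (s 7847503) 7847504 e)) 7848431 (n (n (s 7848463) 7848464 e) 7848495 (s 7848496)))) 7848528
  (n (n (n (n (s 7848529) 7880206 e) 7880207 (n (s 7880238) 7880239 e)) 7880272 (n (n (s 7881198)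
  7881199 e) 7881230 (s 7881231))) 7881263 (n (n (n (s 7881264) 7881295 e) 7881296 (n (s 7882191)
  7882223 e)) 7882255 (n (n (s 7882256) 7882287 e) 7882288 (s 7882320))))) 7883313 (n (n (n (n (n
  (s 7913966) 7913999 e) 7914990 (n (s 7914991) 7915023 e)) 7915055 (n (n (s 7915056) 7916015 e)
  7916047 (n (s 7916048) 7916079 e))) 8864304 (n (n (n (s 8865361) 8896046 e) 8896047 (n (s
  8896079) 8897007 e)) 8897038 (n (n (s 8897039) 8897071 e) 8897072 (s 8897103)))) 8897104 (n (n
  (n (n (s 8898031) 8898064 e) 8898096 (n (s 8898129) 8899153 e)) 8929774 (n (n (s 8929806)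
  8929839 e) 8929871 (s 8930798))) 8930799 (n (n (n (s 8930831) 8930863 e) 8930895 (n (s 8930896)
  8931791 e)) 8931823 (n (n (s 8931824) 8931856 e) 8931888 (s 8931889)))))))) 8932848 (n (n (n (n
  (n (n (n (n (s 8963566) 8963631 e) 8964590 (n (s 8964591) 8964623 e)) 8964655 (n (n (s 9911857)
  9912848 e) 9912881 (n (s 9912913) 9913905 e))) 9944591 (n (n (n (s 9944623) 9944655 e) 9944656
  (n (s 9945583) 9945584 e)) 9945615 (n (n (s 9945616) 9945647 e) 9945648 (s 9945680)))) 9945681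
  (n (n (n (n (s 9946576) 9946608 e) 9946640 (n (s 9946641) 9946673 e)) 9946705 (n (n (s 9947665)
  9947697 e) 9978350 (s 9978351))) 9978383 (n (n (n (s 9978415) 9979343 e) 9979375 (n (s 9979407)
  9979408 e)) 9979440 (n (n (s 9979472) 9980367 e) 9980368 (s 9980399))))) 9980400 (n (n (n (n (n
  (s 9980401) 9980432 e) 9980433 (n (s 9980464) 9980465 e)) 9981392 (n (n (s 9981425) 9981457 e)
  10012143 (n (s 10012175) 10013167 e))) 10013199 (n (n (n (s 10013200) 10960433 e) 10961457 (n
  (s 10993167) 10993199 e)) 10993200 (n (n (s 10993231) 10993232 e) 10994159 (s 10994160))))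
  10994192 (n (n (n (n (s 10994224) 10994225 e) 10994256 (n (s 10994257) 10995184 e)) 10995217 (n
  (n (s 10995249) 10995281 e) 11025934 (s 11025967))) 11025999 (n (n (n (s 11026926) 11026927 e)
  11026959 (n (s 11026991) 11026992 e)) 11027023 (n (n (s 11027024) 11027919 e) 11027951 (s
  11027952)))))) 11027984 (n (n (n (n (n (n (s 11028016) 11028017 e) 11028048 (n (s 11028944)
  11028976 e)) 11028977 (n (n (s 11029009) 11029041 e) 11030001 (n (s 11059694) 11059759 e)))
  11060718 (n (n (n (s 11060719) 11060751 e) 11060783 (n (s 11060784) 11061743 e)) 11061744 (n (n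
  (s 11061775) 11061776 e) 12010000 (s 12010032)))) 12010033 (n (n (n (n (s 12010065) 12010992 e)
  12011057 (n (s 12011089) 12041775 e)) 12041807 (n (n (s 12042735) 12042767 e) 12042799 (s
  12042831))) 12042832 (n (n (n (s 12043759) 12043760 e) 12043792 (n (s 12043824) 12043825 e))
  12043856 (n (n (s 12043857) 12044784 e) 12044817 (s 12044849))))) 12075502 (n (n (n (n (n (s
  12075567) 12076526 e) 12076527 (n (s 12076559) 12076591 e)) 12076624 (n (n (s 12077519)
  12077551 e) 12077552 (n (s 12077583) 12077584 e))) 12077616 (n (n (n (s 12077617) 12078544 e)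
  12078576 (n (s 12078609) 12110318 e)) 12110319 (n (n (s 12110351) 13090352 e) 13122062 (s
  13122095)))) 13122127 (n (n (n (n (s 13123055) 13123087 e) 13123119 (n (s 13123120) 13123152
  e)) 13124079 (n (n (s 13124144) 13155822 e) 13155887 (s 13156846))) 13156847 (n (n (n (s
  13156879) 13156911 e) 13156912 (n (s 13156944) 13157839 e)) 13157871 (n (n (s 13157904)
  13157936 e) 13190639 (s 13190671))))))) 14137872 (n (n (n (n (n (n (n (s 14137904) 14138896 e)
  14138929 (n (s 14138961) 14170607 e)) 14170639 (n (n (s 14170671) 14171631 e) 14171632 (n (s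
  14171663) 14171664 e))) 14171696 (n (n (n (s 14171697) 14171728 e) 14171729 (n (s 14172623)
  14172656 e)) 14172688 (n (n (s 14172721) 14172753 e) 14173745 (s 14204399)))) 14204431 (n (n (n
  (n (s 14205391) 14205423 e) 14205424 (n (s 14205455) 14205456 e)) 14205488 (n (n (s 14205520)
  14206415 e) 14206416 (s 14206448))) 14206480 (n (n (n (s 14206481) 14239215 e) 15186448 (n (s
  15186480) 15218223 e)) 15218255 (n (n (s 15219183) 15219215 e) 15219247 (s 15219248)))))
  15219280 (n (n (n (n (n (s 15220207) 15220208 e) 15220240 (n (s 15220272) 15220273 e)) 15220305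
  (n (n (s 15221232) 15221297 e) 15251950 (n (s 15252015) 15252974 e))) 15252975 (n (n (n (s
  15253007) 15253039 e) 15253040 (n (s 15253072) 15253967 e)) 15253999 (n (n (s 15254000)
  15254032 e) 15254064 (s 15254065)))) 15255024 (n (n (n (n (s 15255057) 15286767 e) 15286799 (n
  (s 15287791) 16235056 e)) 16236048 (n (n (s 16236080) 16236113 e) 16267823 (s 16268783)))
  16268815 (n (n (n (s 16268847) 16268848 e) 16268880 (n (s 16269775) 16269807 e)) 16269808 (n (n
  (s 16269840) 16269872 e) 16269873 (s 16269905)))))) 16270832 (n (n (n (n (n (n (s 16270897)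
  16302575 e) 16302607 (n (s 16302672) 16303567 e)) 16303599 (n (n (s 16303600) 16303632 e)
  16303664 (n (s 16304624) 16336367 e))) 17251889 (n (n (n (s 17283600) 17283632 e) 17283633 (n
  (s 17284592) 17284624 e)) 17284625 (n (n (s 17284657) 17284689 e) 17285584 (s 17285616))))
  17285617 (n (n (n (n (s 17285649) 17285681 e) 17285682 (n (s 17317360) 17317392 e)) 17317425 (n
  (n (s 17317457) 17318352 e) 17318384 (s 17318385))) 17318417 (n (n (n (s 17318449) 17319376 e)
  17319409 (n (s 17319441) 17320433 e)) 17351119 (n (n (s 17351120) 17351152 e) 17351184 (s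
  17352144))))) 17352176 (n (n (n (n (n (s 17352177) 17352209 e) 18300433 (n (s 18300466)
  18332145 e)) 18332176 (n (n (s 18332177) 18332209 e) 18332210 (n (s 18333137) 18333168 e)))
  18333169 (n (n (n (s 18333201) 18333202 e) 18333233 (n (s 18333234) 18334160 e)) 18334161 (n (n
  (s 18334193) 18334194 e) 18334225 (s 18334226)))) 18334258 (n (n (n (n (s 18334259) 18365904 e)
  18365936 (n (s 18365937) 18365969 e)) 18366001 (n (n (s 18366928) 18366929 e) 18366961 (s
  18366993))) 18366994 (n (n (n (s 18367026) 18367921 e) 18367953 (n (s 18367985) 18367986 e))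
  18368018 (n (n (s 18368977) 18369010 e) 18399696 (s 18399728))))))))) 18400720 (n (n (n (n (n
  (n (n (n (n (s 18400721) 18400753 e) 18400785 (n (s 19380721) 19380752 e)) 19380753 (n (n (s
  19380785) 19380786 e) 19381713 (n (s 19381745) 19381777 e))) 19381778 (n (n (n (s 19381809)
  19381810 e) 19382802 (n (s 19382834) 19413488 e)) 19413520 (n (n (s 19413553) 19413585 e)
  19414480 (s 19414512)))) 19414513 (n (n (n (n (s 19414545) 19414577 e) 19414578 (n (s 19415473)
  19415504 e)) 19415505 (n (n (s 19415537) 19415538 e) 19415569 (s 19415570))) 19415602 (n (n (n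
  (s 19416529) 19416562 e) 19416594 (n (s 19447247) 19447248 e)) 19447280 (n (n (s 19447312)
  19448272 e) 19448273 (s 19448304))))) 19448305 (n (n (n (n (n (s 19448337) 19448369 e) 19449296
  (n (s 19449297) 19449329 e)) 19449330 (n (n (s 19449361) 20397585 e) 20397617 (n (s 20397618)
  20429328 e))) 20429361 (n (n (n (s 20430320) 20430321 e) 20430353 (n (s 20430385) 20431312 e))
  20431313 (n (n (s 20431345) 20431377 e) 20431378 (s 20431410)))) 20432402 (n (n (n (n (s
  20432434) 20463056 e) 20463088 (n (s 20463120) 20464080 e)) 20464112 (n (n (s 20464113)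
  20464145 e) 20464177 (s 20464178))) 20465104 (n (n (n (s 20465105) 20465137 e) 20465169 (n (s
  20465170) 20466129 e)) 20466161 (n (n (s 20466162) 20497872 e) 20497905 (s 20497937))))))
  21477936 (n (n (n (n (n (n (s 21478927) 21478928 e) 21478959 (n (s 21478960) 21478991 e))
  21478992 (n (n (s 21478993) 21479952 e) 21479984 (n (s 21479985) 21480016 e))) 21480017 (n (n
  (n (s 21511663) 21511694 e) 21511695 (n (s 21511727) 21511728 e)) 21511759 (n (n (s 21511760)
  21512655 e) 21512686 (s 21512687)))) 21512719 (n (n (n (n (s 21512720) 21512751 e) 21512752 (n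
  (s 21512784) 21512785 e)) 21513679 (n (n (s 21513712) 21513743 e) 21513744 (s 21513776)))
  21513777 (n (n (n (s 21513808) 21545423 e) 21545454 (n (s 21545455) 21545486 e)) 21545487 (n (n
  (s 21545488) 21545520 e) 21545552 (s 21546447))))) 21546478 (n (n (n (n (n (s 21546479)
  21546511 e) 21546512 (n (s 21546543) 21546544 e)) 21547503 (n (n (s 21547504) 21547535 e)
  21547536 (n (s 21579247) 21579279 e))) 22526480 (n (n (n (s 22526512) 22526513 e) 22527472 (n
  (s 22527503) 22527504 e)) 22527505 (n (n (s 22527535) 22527536 e) 22527537 (s 22527568))))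
  22527569 (n (n (n (n (s 22528496) 22528528 e) 22528529 (n (s 22528560) 22528561 e)) 22528562 (n
  (n (s 22528592) 22528593 e) 22560239 (s 22560240))) 22560271 (n (n (n (s 22560272) 22560303 e)
  22560304 (n (s 22560305) 22560337 e)) 22561231 (n (n (s 22561232) 22561263 e) 22561264 (s
  22561295))))))) 22561296 (n (n (n (n (n (n (n (s 22561297) 22561328 e) 22561329 (n (s 22561360)
  22561361 e)) 22562256 (n (n (s 22562287) 22562288 e) 22562289 (n (s 22562320) 22562321 e)))
  22562352 (n (n (n (s 22562353) 22593999 e) 22594000 (n (s 22594030) 22594031 e)) 22594032 (n (n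
  (s 22594064) 22594096 e) 22595023 (s 22595024)))) 22595055 (n (n (n (n (s 22595056) 22595087 e)
  22595088 (n (s 22595089) 22595120 e)) 22596079 (n (n (s 22596080) 22596112 e) 22627823 (s
  23575056))) 23575088 (n (n (n (s 23575089) 23576048 e) 23576079 (n (s 23576080) 23576081 e))
  23576112 (n (n (s 23576113) 23576144 e) 23576145 (s 23607791))))) 23607822 (n (n (n (n (n (s
  23607823) 23607824 e) 23607855 (n (s 23607856) 23607887 e)) 23607888 (n (n (s 23608815)
  23608816 e) 23608847 (n (s 23608848) 23608879 e))) 23608880 (n (n (n (s 23608881) 23608912 e)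
  23608913 (n (s 23609807) 23609808 e)) 23609839 (n (n (s 23609840) 23609871 e) 23609872 (s
  23609873)))) 23609904 (n (n (n (n (s 23609905) 23609936 e) 23609937 (n (s 23610897) 23641551
  e)) 23641582 (n (n (s 23641583) 23641614 e) 23641615 (s 23641616))) 23641648 (n (n (n (s
  23641680) 23642575 e) 23642576 (n (s 23642606) 23642607 e)) 23642608 (n (n (s 23642639)
  23642640 e) 23642641 (s 23642671)))))) 23642672 (n (n (n (n (n (n (s 23642673) 23642704 e)
  23643599 (n (s 23643600) 23643631 e)) 23643632 (n (n (s 23643663) 23643664 e) 23643665 (n (s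
  23643696) 23644656 e))) 23644688 (n (n (n (s 23675343) 23675375 e) 23676399 (n (s 23676431)
  24623632 e)) 24623664 (n (n (s 24624655) 24624656 e) 24624687 (s 24624688)))) 24624720 (n (n (n
  (n (s 24624721) 24625616 e) 24625647 (n (s 24625648) 24625679 e)) 24625680 (n (n (s 24625681)
  24625712 e) 24625713 (s 24625744))) 24625745 (n (n (n (s 24657391) 24657422 e) 24657423 (n (s
  24657424) 24657456 e)) 24657488 (n (n (s 24658383) 24658414 e) 24658415 (s 24658416)))))
  24658447 (n (n (n (n (n (s 24658448) 24658479 e) 24658480 (n (s 24658481) 24658512 e)) 24658513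
  (n (n (s 24659407) 24659408 e) 24659439 (n (s 24659440) 24659471 e))) 24659472 (n (n (n (s
  24659473) 24659504 e) 24659505 (n (s 24659536) 24660497 e)) 24691151 (n (n (s 24691183)
  24692175 e) 24692207 (s 24692208)))) 24692239 (n (n (n (n (s 24692240) 24692272 e) 24693231 (n
  (s 24693232) 24693264 e)) 25640497 (n (n (s 25641488) 25641521 e) 25641553 (s 25642545)))
  25673231 (n (n (n (s 25673263) 25673295 e) 25673296 (n (s 25674223) 25674224 e)) 25674255 (n (n
  (s 25674256) 25674287 e) 25674288 (s 25674320)))))))) 25674321 (n (n (n (n (n (n (n (n (s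
  25675216) 25675248 e) 25675280 (n (s 25675281) 25675313 e)) 25675345 (n (n (s 25676305)
  25676337 e) 25706990 (n (s 25706991) 25707023 e))) 25707055 (n (n (n (s 25707983) 25708015 e)
  25708047 (n (s 25708048) 25708080 e)) 25708112 (n (n (s 25709007) 25709008 e) 25709039 (s
  25709040)))) 25709041 (n (n (n (n (s 25709072) 25709073 e) 25709104 (n (s 25709105) 25710032
  e)) 25710065 (n (n (s 25710097) 25740783 e) 25740815 (s 25741807))) 25741839 (n (n (n (s
  25741840) 26689041 e) 26689073 (n (s 26690033) 26690065 e)) 26690097 (n (n (s 26690098)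
  26690129 e) 26691089 (s 26691122))))) 26721807 (n (n (n (n (n (s 26721808) 26721839 e) 26721840
  (n (s 26721872) 26721873 e)) 26722768 (n (n (s 26722799) 26722800 e) 26722831 (n (s 26722832)
  26722833 e))) 26722864 (n (n (n (s 26722865) 26722896 e) 26722897 (n (s 26723792) 26723793 e))
  26723824 (n (n (s 26723825) 26723857 e) 26723858 (s 26723889)))) 26723890 (n (n (n (n (s
  26723921) 26724849 e) 26724882 (n (s 26724914) 26755535 e)) 26755567 (n (n (s 26755599)
  26756559 e) 26756560 (s 26756591))) 26756592 (n (n (n (s 26756624) 26756656 e) 26756657 (n (s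
  26757583) 26757584 e)) 26757585 (n (n (s 26757616) 26757617 e) 26757648 (s 26757649))))))
  26757681 (n (n (n (n (n (n (s 26758609) 26758641 e) 26758673 (n (s 26790383) 26790384 e))
  26790416 (n (n (s 27737617) 27737649 e) 27737650 (n (s 27738609) 27738641 e))) 27738674 (n (n
  (n (s 27770352) 27770383 e) 27770384 (n (s 27770415) 27770416 e)) 27770448 (n (n (s 27770449)
  27771344 e) 27771376 (s 27771377)))) 27771408 (n (n (n (n (s 27771409) 27771440 e) 27771441 (n
  (s 27771473) 27772368 e)) 27772401 (n (n (s 27772433) 27772434 e) 27772465 (s 27772466)))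
  27773490 (n (n (n (s 27803119) 27803151 e) 27803183 (n (s 27804111) 27804143 e)) 27804144 (n (n
  (s 27804175) 27804176 e) 27804208 (s 27804240))))) 27804241 (n (n (n (n (n (s 27805135)
  27805136 e) 27805168 (n (s 27805169) 27805200 e)) 27805201 (n (n (s 27805232) 27805233 e)
  27806160 (n (s 27806161) 27806193 e))) 27806194 (n (n (n (s 27806225) 27807185 e) 27836911 (n
  (s 27836943) 27837903 e)) 27837935 (n (n (s 27837936) 27837967 e) 27837968 (s 27838000))))
  27838959 (n (n (n (n (s 27838960) 27838992 e) 28787185 (n (s 28787216) 28787217 e)) 28787249 (n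
  (n (s 28787281) 28788209 e) 28788241 (s 28788273))) 28788274 (n (n (n (s 28818959) 28818991 e)
  28819951 (n (s 28819983) 28819984 e)) 28820016 (n (n (s 28820048) 28820049 e) 28820944 (s
  28820976))))))) 28820977 (n (n (n (n (n (n (n (s 28821008) 28821009 e) 28821040 (n (s 28821041)
  28821073 e)) 28821968 (n (n (s 28822001) 28822033 e) 28822034 (n (s 28822066) 28852719 e)))
  28852751 (n (n (n (s 28853711) 28853743 e) 28853775 (n (s 28853776) 28853808 e)) 28853840 (n (n
  (s 28854735) 28854736 e) 28854767 (s 28854768)))) 28854769 (n (n (n (n (s 28854800) 28854801 e)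
  28854832 (n (s 28854833) 28855760 e)) 28855761 (n (n (s 28855793) 28855825 e) 28887535 (s
  28887568))) 29866512 (n (n (n (s 29866544) 29867536 e) 29867569 (n (s 29867601) 29899247 e))
  29899279 (n (n (s 29899311) 29900271 e) 29900272 (s 29900303))))) 29900304 (n (n (n (n (n (s
  29900336) 29900337 e) 29900368 (n (s 29900369) 29901263 e)) 29901296 (n (n (s 29901328)
  29901361 e) 29901393 (n (s 29902385) 29933039 e))) 29933071 (n (n (n (s 29934031) 29934063 e)
  29934064 (n (s 29934095) 29934096 e)) 29934128 (n (n (s 29934160) 29935055 e) 29935056 (s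
  29935088)))) 29935120 (n (n (n (n (s 29935121) 29967855 e) 30915088 (n (s 30915089) 30915120
  e)) 30915121 (n (n (s 30916080) 30916113 e) 30916145 (s 30916146))) 30916177 (n (n (n (s
  30947823) 30947855 e) 30948816 (n (s 30948847) 30948848 e)) 30948849 (n (n (s 30948880)
  30948881 e) 30948912 (s 30948913)))))) 30948945 (n (n (n (n (n (n (s 30949840) 30949872 e)
  30949873 (n (s 30949905) 30949937 e)) 30949938 (n (n (s 30949969) 30950929 e) 30982607 (n (s
  30982608) 30982640 e))) 30982672 (n (n (n (s 30982673) 30982705 e) 30983632 (n (s 30983633)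
  30983664 e)) 30983665 (n (n (s 30983697) 31963664 e) 31963665 (s 31963697)))) 31995407 (n (n (n
  (n (s 31995439) 31996399 e) 31996400 (n (s 31996431) 31996432 e)) 31996464 (n (n (s 31996465)
  31996496 e) 31996497 (s 31997392))) 31997424 (n (n (n (s 31997425) 31997456 e) 31997457 (n (s
  31997489) 31997490 e)) 31997521 (n (n (s 31998416) 31998449 e) 31998481 (s 31998514)))))
  32029167 (n (n (n (n (n (s 32029199) 32030159 e) 32030191 (n (s 32030192) 32030223 e)) 32030224
  (n (n (s 32030256) 32030288 e) 32031183 (n (s 32031184) 32031216 e))) 32031217 (n (n (n (s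
  32031248) 32031249 e) 32031281 (n (s 32032208) 32032241 e)) 32032273 (n (n (s 32063951)
  32063983 e) 32064016 (s 33012240)))) 33012272 (n (n (n (n (s 33012273) 33013232 e) 33013264 (n
  (s 33013265) 33013297 e)) 33013329 (n (n (s 33044975) 33045007 e) 33045999 (s 33046000)))
  33046031 (n (n (n (s 33046032) 33046064 e) 33046096 (n (s 33046097) 33046991 e)) 33046992 (n (n
  (s 33047024) 33047025 e) 33047056 (s 33047057)))))))))) 33047089 (n (n (n (n (n (n (n (n (n (n
  (s 33047121) 33048016 e) 33048049 (n (s 33048081) 33048113 e)) 33079759 (n (n (s 33079791)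
  33079824 e) 33079856 (n (s 33080783) 33080784 e))) 33080816 (n (n (n (s 33080817) 33080848 e)
  33080849 (n (s 34060816) 34060848 e)) 34060849 (n (n (s 34061808) 34061841 e) 34061873 (s
  34061905)))) 34093551 (n (n (n (n (s 34093584) 34093616 e) 34094575 (n (s 34094576) 34094608
  e)) 34094641 (n (n (s 34094673) 34095568 e) 34095600 (n (s 34095601) 34095633 e))) 34095665 (n
  (n (n (s 34095666) 34095697 e) 34096625 (n (s 34127311) 34127343 e)) 34127376 (n (n (s
  34127408) 34128335 e) 34128336 (s 34128368))))) 34128400 (n (n (n (n (n (s 34128401) 34128433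
  e) 34129360 (n (s 34129392) 34129393 e)) 34129425 (n (n (s 34161103) 35109361 e) 35109392 (n (s
  35109393) 35109425 e))) 35109426 (n (n (n (s 35110353) 35110385 e) 35110417 (n (s 35110418)
  35110449 e)) 35110450 (n (n (s 35111442) 35111474 e) 35142128 (s 35142160)))) 35142193 (n (n (n
  (n (s 35142225) 35143120 e) 35143152 (n (s 35143153) 35143185 e)) 35143217 (n (n (s 35143218)
  35144113 e) 35144144 (s 35144145))) 35144177 (n (n (n (s 35144178) 35144209 e) 35144210 (n (s
  35144242) 35145169 e)) 35145202 (n (n (s 35145234) 35175887 e) 35175888 (s 35175920))))))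
  35175952 (n (n (n (n (n (n (s 35176912) 35176913 e) 35176944 (n (s 35176945) 35176977 e))
  35177009 (n (n (s 35177936) 35177937 e) 35177969 (n (s 35177970) 35178001 e))) 36157937 (n (n
  (n (s 36157969) 36158001 e) 36158002 (n (s 36158961) 36158994 e)) 36159026 (n (n (s 36189744)
  36190703 e) 36190704 (s 36190736)))) 36190737 (n (n (n (n (s 36190769) 36190801 e) 36191696 (n
  (s 36191728) 36191729 e)) 36191761 (n (n (s 36191793) 36191794 e) 36191825 (s 36192721)))
  36192753 (n (n (n (s 36192786) 36192818 e) 36223439 (n (s 36223471) 36224463 e)) 36224464 (n (n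
  (s 36224496) 36224528 e) 36224529 (s 36224561))))) 36225488 (n (n (n (n (n (s 36225489)
  36225520 e) 36225521 (n (s 36225553) 36225554 e)) 36225585 (n (n (s 36226513) 36226545 e)
  36226546 (n (s 36257231) 36258256 e))) 36258288 (n (n (n (s 37206544) 37206545 e) 37206577 (n
  (s 37207536) 37207537 e)) 37207569 (n (n (s 37207601) 37207602 e) 37207633 (s 37208561))))
  37208594 (n (n (n (n (s 37208626) 37239279 e) 37240272 (n (s 37240304) 37240336 e)) 37240337 (n
  (n (s 37240369) 37240401 e) 37241296 (s 37241328))) 37241329 (n (n (n (s 37241361) 37241393 e)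
  37241394 (n (s 37242321) 37242353 e)) 37242386 (n (n (s 37273039) 37274064 e) 37274096 (s
  37274161))))))) 37275088 (n (n (n (n (n (n (n (s 37275120) 37275121 e) 37275153 (n (s 38255152)
  38256143 e)) 38256144 (n (n (s 38256175) 38256176 e) 38256208 (n (s 38256209) 38287886 e)))
  38287887 (n (n (n (s 38287918) 38287919 e) 38287951 (n (s 38287952) 38288879 e)) 38288910 (n (n
  (s 38288911) 38288943 e) 38288944 (s 38288975)))) 38288976 (n (n (n (n (s 38289871) 38289903 e)
  38289935 (n (s 38289936) 38289967 e)) 38289968 (n (n (s 38290000) 38290001 e) 38290993 (s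
  38321646))) 38321678 (n (n (n (s 38321679) 38321710 e) 38321711 (n (s 38321744) 38322639 e))
  38322670 (n (n (s 38322671) 38322702 e) 38322703 (s 38322704))))) 38322735 (n (n (n (n (n (s
  38322736) 38322767 e) 38322768 (n (s 38323663) 38323695 e)) 38323696 (n (n (s 38323727)
  38323728 e) 38323759 (n (s 38323760) 38324720 e))) 38324752 (n (n (n (s 38355438) 38355471 e)
  38356462 (n (s 38356463) 38356495 e)) 39303696 (n (n (s 39303728) 39303729 e) 39304688 (s
  39304719)))) 39304720 (n (n (n (n (s 39304721) 39304752 e) 39304753 (n (s 39304784) 39304785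
  e)) 39336431 (n (n (s 39336462) 39336463 e) 39336464 (s 39336495))) 39336496 (n (n (n (s
  39336527) 39336528 e) 39337455 (n (s 39337456) 39337487 e)) 39337488 (n (n (s 39337519)
  39337520 e) 39337521 (s 39337552)))))) 39337553 (n (n (n (n (n (n (s 39338447) 39338448 e)
  39338479 (n (s 39338480) 39338511 e)) 39338512 (n (n (s 39338513) 39338544 e) 39338545 (n (s
  39338576) 39338577 e))) 39339537 (n (n (n (s 39370191) 39370222 e) 39370223 (n (s 39370254)
  39370255 e)) 39370256 (n (n (s 39370288) 39370320 e) 39371215 (s 39371216)))) 39371246 (n (n (n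
  (n (s 39371247) 39371248 e) 39371279 (n (s 39371280) 39371281 e)) 39371311 (n (n (s 39371312)
  39371313 e) 39371344 (s 39372239))) 39372240 (n (n (n (s 39372271) 39372272 e) 39372303 (n (s
  39372304) 39372305 e)) 39372336 (n (n (s 39373296) 39373328 e) 39403983 (s 39404015)))))
  39405039 (n (n (n (n (n (s 39405071) 40352272 e) 40352304 (n (s 40352305) 40384015 e)) 40384047
  (n (n (s 40384079) 40385007 e) 40385038 (n (s 40385039) 40385040 e))) 40385071 (n (n (n (s
  40385072) 40385103 e) 40385104 (n (s 40385105) 40386031 e)) 40386032 (n (n (s 40386063)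
  40386064 e) 40386096 (s 40386097)))) 40386128 (n (n (n (n (s 40386129) 40387089 e) 40387153 (n
  (s 40417774) 40417807 e)) 40417839 (n (n (s 40418767) 40418798 e) 40418799 (s 40418830)))
  40418831 (n (n (n (s 40418832) 40418863 e) 40418864 (n (s 40418895) 40418896 e)) 40419791 (n (n
  (s 40419792) 40419823 e) 40419824 (s 40419855)))))))) 40419856 (n (n (n (n (n (n (n (n (s
  40419857) 40419888 e) 40419889 (n (s 40419920) 40420815 e)) 40420816 (n (n (s 40420848)
  40420849 e) 40420880 (n (s 40420881) 40451566 e))) 40451599 (n (n (n (s 40452559) 40452590 e)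
  40452591 (n (s 40452624) 40452655 e)) 40453615 (n (n (s 40453647) 41400848 e) 41400880 (s
  41401840)))) 41401871 (n (n (n (n (s 41401872) 41401904 e) 41401936 (n (s 41401937) 41433615
  e)) 41433647 (n (n (s 41434607) 41434638 e) 41434639 (s 41434640))) 41434671 (n (n (n (s
  41434672) 41434703 e) 41434704 (n (s 41434705) 41435599 e)) 41435631 (n (n (s 41435632)
  41435663 e) 41435664 (s 41435696))))) 41435697 (n (n (n (n (n (s 41435728) 41435729 e) 41436689
  (n (s 41436721) 41467374 e)) 41467407 (n (n (s 41468367) 41468398 e) 41468399 (n (s 41468432)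
  41468463 e))) 41468464 (n (n (n (s 41468496) 41469391 e) 41469423 (n (s 41469424) 41469455 e))
  41469456 (n (n (s 41469487) 41469488 e) 41470448 (s 41470480)))) 41502190 (n (n (n (n (s
  41502191) 42417713 e) 42418737 (n (s 42450447) 42450479 e)) 42450480 (n (n (s 42450511)
  42450512 e) 42451439 (s 42451440))) 42451472 (n (n (n (s 42451504) 42451505 e) 42451536 (n (s
  42451537) 42452464 e)) 42452497 (n (n (s 42452529) 42452561 e) 42483214 (s 42483247))))))
  42483279 (n (n (n (n (n (n (s 42484206) 42484207 e) 42484239 (n (s 42484271) 42484272 e))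
  42484303 (n (n (s 42484304) 42485199 e) 42485231 (n (s 42485232) 42485264 e))) 42485296 (n (n
  (n (s 42485297) 42485328 e) 42486224 (n (s 42486256) 42486257 e)) 42486289 (n (n (s 42486321)
  42487281 e) 42516974 (s 42517039)))) 42517998 (n (n (n (n (s 42517999) 42518031 e) 42518063 (n
  (s 42518064) 42519023 e)) 42519024 (n (n (s 42519055) 42519056 e) 43466257 (s 43466289)))
  43466290 (n (n (n (s 43467249) 43467281 e) 43467314 (n (s 43498992) 43499023 e)) 43499024 (n (n
  (s 43499055) 43499056 e) 43499088 (s 43499089))))) 43499984 (n (n (n (n (n (s 43500016)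
  43500017 e) 43500048 (n (s 43500049) 43500080 e)) 43500081 (n (n (s 43500113) 43501008 e)
  43501041 (n (s 43501073) 43501074 e))) 43501105 (n (n (n (s 43501106) 43502130 e) 43531759 (n
  (s 43531791) 43531823 e)) 43532751 (n (n (s 43532783) 43532784 e) 43532815 (s 43532816))))
  43532848 (n (n (n (n (s 43532880) 43532881 e) 43533775 (n (s 43533776) 43533808 e)) 43533809 (n
  (n (s 43533840) 43533841 e) 43533872 (s 43533873))) 43534800 (n (n (n (s 43534801) 43534833 e)
  43534834 (n (s 43534865) 43535825 e)) 43565551 (n (n (s 43565583) 43566543 e) 43566575 (s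
  43566576))))))) 43566607 (n (n (n (n (n (n (n (s 43566608) 43566640 e) 43567599 (n (s 43567600)
  43567632 e)) 44514833 (n (n (s 44514865) 44514866 e) 44546608 (n (s 44547568) 44547600 e)))
  44547632 (n (n (n (s 44547633) 44547665 e) 44548560 (n (s 44548592) 44548593 e)) 44548625 (n (n
  (s 44548657) 44548658 e) 44549617 (s 44549682)))) 44579342 (n (n (n (n (s 44579375) 44579407 e)
  44580335 (n (s 44580367) 44580399 e)) 44580400 (n (n (s 44580431) 44580432 e) 44581327 (s
  44581359))) 44581360 (n (n (n (s 44581392) 44581424 e) 44581425 (n (s 44581456) 44581457 e))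
  44582352 (n (n (s 44582384) 44582385 e) 44582417 (s 44582449))))) 44583377 (n (n (n (n (n (s
  44583409) 44613102 e) 44613167 (n (s 44614126) 44614127 e)) 44614159 (n (n (s 44614191)
  44614192 e) 44614224 (n (s 44615119) 44615151 e))) 44615152 (n (n (n (s 44615184) 44615216 e)
  44616176 (n (s 44647918) 44647919 e)) 44647951 (n (n (s 45563441) 45564433 e) 45564465 (s
  45564466)))) 45596175 (n (n (n (n (s 45596207) 45596208 e) 45596239 (n (s 45596240) 45597167
  e)) 45597168 (n (n (s 45597200) 45597232 e) 45597233 (s 45597264))) 45597265 (n (n (n (s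
  45598160) 45598192 e) 45598193 (n (s 45598225) 45598257 e)) 45598258 (n (n (s 45599217)
  45599282 e) 45628975 (s 45629934)))))) 45629935 (n (n (n (n (n (n (s 45629967) 45629999 e)
  45630000 (n (s 45630032) 45630927 e)) 45630959 (n (n (s 45630960) 45630992 e) 45631024 (n (s
  45631025) 45631056 e))) 45631952 (n (n (n (s 45631984) 45631985 e) 45632017 (n (s 45632049)
  45632977 e)) 45633009 (n (n (s 45663726) 45663727 e) 45663759 (s 45664751)))) 45664752 (n (n (n
  (n (s 45664784) 46643728 e) 46643760 (n (s 46675503) 46675535 e)) 46676463 (n (n (s 46676495)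
  46676527 e) 46676528 (s 46676560))) 46677487 (n (n (n (s 46677488) 46677520 e) 46677552 (n (s
  46677553) 46677585 e)) 46678512 (n (n (s 46678577) 46709230 e) 46709295 (s 46710254)))))
  46710255 (n (n (n (n (n (s 46710287) 46710319 e) 46710320 (n (s 46710352) 46711247 e)) 46711279
  (n (n (s 46711280) 46711312 e) 46711344 (n (s 46711345) 46712304 e))) 46712337 (n (n (n (s
  46744047) 46744079 e) 46745071 (n (s 47692304) 47692305 e)) 47692337 (n (n (s 47724047)
  47724079 e) 47725039 (s 47725040)))) 47725071 (n (n (n (n (s 47725072) 47725104 e) 47725105 (n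
  (s 47725136) 47725137 e)) 47726032 (n (n (s 47726064) 47726065 e) 47726096 (s 47726097)))
  47726129 (n (n (n (s 47726130) 47726161 e) 47727056 (n (s 47727089) 47727121 e)) 47727154 (n (n
  (s 47757807) 47757839 e) 47758799 (s 47758831))))))))) 47758832 (n (n (n (n (n (n (n (n (n (s
  47758863) 47758864 e) 47758896 (n (s 47758928) 47759823 e)) 47759824 (n (n (s 47759856)
  47759857 e) 47759888 (n (s 47759889) 47759921 e))) 47760848 (n (n (n (s 47760881) 47760913 e)
  47792591 (n (s 47792623) 47792656 e)) 48740913 (n (n (s 48772623) 48772656 e) 48772688 (s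
  48773616)))) 48773648 (n (n (n (n (s 48773680) 48773681 e) 48773713 (n (s 48774608) 48774673
  e)) 48774705 (n (n (s 48774706) 48805423 e) 48806383 (s 48806415))) 48806447 (n (n (n (s
  48806448) 48806480 e) 48807375 (n (s 48807407) 48807408 e)) 48807440 (n (n (s 48807472)
  48807473 e) 48808400 (s 48808432))))) 48808433 (n (n (n (n (n (s 48808465) 48808497 e) 48809457
  (n (s 48840175) 48840207 e)) 48841167 (n (n (s 48841199) 48841200 e) 48841232 (n (s 49789456)
  49789488 e))) 49789489 (n (n (n (s 49790513) 49821231 e) 49822191 (n (s 49822223) 49822255 e))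
  49822256 (n (n (s 49822288) 49823215 e) 49823216 (s 49823248)))) 49823280 (n (n (n (n (s
  49823281) 49823313 e) 49824208 (n (s 49824240) 49824273 e)) 49824305 (n (n (s 49824306)
  49855983 e) 49856015 (s 49856080))) 49856975 (n (n (n (s 49857007) 49857008 e) 49857040 (n (s
  49857072) 49857073 e)) 49858000 (n (n (s 49858032) 49858033 e) 49858065 (s 49889775))))))
  49890799 (n (n (n (n (n (n (s 50806321) 50838032 e) 50838064 (n (s 50839024) 50839056 e))
  50839089 (n (n (s 50839121) 50840016 e) 50840048 (n (s 50840081) 50840113 e))) 50840145 (n (n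
  (n (s 50871791) 50871824 e) 50871856 (n (s 50872783) 50872816 e)) 50872848 (n (n (s 50872881)
  50872913 e) 50873808 (s 50873840)))) 50873873 (n (n (n (n (s 50873905) 50874865 e) 50874897 (n
  (s 50905551) 50906608 e)) 50907632 (n (n (s 51854865) 51854897 e) 51854898 (s 51886608)))
  51886641 (n (n (n (s 51887600) 51887601 e) 51887633 (n (s 51887665) 51888592 e)) 51888593 (n (n
  (s 51888625) 51888657 e) 51888658 (s 51888690))))) 51889682 (n (n (n (n (n (s 51889714)
  51920336 e) 51920368 (n (s 51920400) 51921360 e)) 51921392 (n (n (s 51921393) 51921425 e)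
  51921457 (n (s 51921458) 51922384 e))) 51922385 (n (n (n (s 51922417) 51922449 e) 51922450 (n
  (s 51923409) 51923441 e)) 51923442 (n (n (s 51955152) 51955185 e) 51955217 (s 52935184))))
  52935185 (n (n (n (n (s 52935217) 52936176 e) 52936177 (n (s 52936209) 52936241 e)) 52936242 (n
  (n (s 52936273) 52937201 e) 52937234 (s 52937266))) 52967919 (n (n (n (s 52968912) 52968944 e)
  52968976 (n (s 52968977) 52969009 e)) 52969041 (n (n (s 52969936) 52969968 e) 52969969 (s
  52970001))))))) 52970033 (n (n (n (n (n (n (n (s 52970034) 52970961 e) 52970993 (n (s 52971026)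
  53001679 e)) 53002704 (n (n (s 53002736) 53002801 e) 53003728 (n (s 53003760) 53003761 e)))
  53003793 (n (n (n (s 53952017) 53952049 e) 53984752 (n (s 53984784) 53984817 e)) 53984849 (n (n
  (s 53985744) 53985776 e) 53985777 (s 53985809)))) 53985841 (n (n (n (n (s 53986801) 53986866 e)
  54018544 (n (s 54018609) 54019536 e)) 54019568 (n (n (s 54019569) 54019601 e) 54019633 (s
  54020561))) 54020593 (n (n (n (s 54052336) 55033359 e) 55033391 (n (s 55033423) 55033424 e))
  55034351 (n (n (s 55034383) 55034384 e) 55034415 (s 55034416))))) 55034448 (n (n (n (n (n (s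
  55034449) 55066126 e) 55066127 (n (s 55066158) 55066159 e)) 55066192 (n (n (s 55067118)
  55067119 e) 55067150 (n (s 55067151) 55067183 e))) 55067184 (n (n (n (s 55067215) 55067216 e)
  55068111 (n (s 55068143) 55068175 e)) 55068176 (n (n (s 55068207) 55068208 e) 55068240 (s
  55069233)))) 55099886 (n (n (n (n (s 55099919) 55100910 e) 55100911 (n (s 55100943) 55100975
  e)) 55100976 (n (n (s 55101935) 55101967 e) 55101968 (s 55101999))) 56080912 (n (n (n (s
  56080944) 56081935 e) 56081936 (n (s 56081967) 56081968 e)) 56082000 (n (n (s 56082001)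
  56082896 e) 56082927 (s 56082928)))))) 56082959 (n (n (n (n (n (n (s 56082960) 56082961 e)
  56082992 (n (s 56082993) 56083024 e)) 56083025 (n (n (s 56114671) 56114702 e) 56114703 (n (s
  56114704) 56114736 e))) 56114768 (n (n (n (s 56115663) 56115694 e) 56115695 (n (s 56115696)
  56115727 e)) 56115728 (n (n (s 56115759) 56115760 e) 56115761 (s 56115792)))) 56115793 (n (n (n
  (n (s 56116687) 56116688 e) 56116719 (n (s 56116720) 56116751 e)) 56116752 (n (n (s 56116753)
  56116784 e) 56116785 (s 56116816))) 56117777 (n (n (n (s 56148431) 56148463 e) 56149455 (n (s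
  56149487) 56149488 e)) 56149519 (n (n (s 56149520) 56149552 e) 56150511 (s 56150512)))))
  56150544 (n (n (n (n (n (s 57129488) 57129520 e) 57130480 (n (s 57130511) 57130512 e)) 57130544
  (n (n (s 57130576) 57130577 e) 57162255 (n (s 57162287) 57163247 e))) 57163278 (n (n (n (s
  57163279) 57163280 e) 57163311 (n (s 57163312) 57163343 e)) 57163344 (n (n (s 57163345)
  57164239 e) 57164271 (s 57164272)))) 57164303 (n (n (n (n (s 57164304) 57164336 e) 57164337 (n
  (s 57164368) 57164369 e)) 57165329 (n (n (s 57165361) 57196014 e) 57196047 (s 57197007)))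
  57197038 (n (n (n (s 57197039) 57197072 e) 57197103 (n (s 57197104) 57197136 e)) 57198031 (n (n
  (s 57198063) 57198064 e) 57198095 (s 57198096)))))))) 57198127 (n (n (n (n (n (n (n (n (s
  57198128) 57199088 e) 57199120 (n (s 57230830) 57230831 e)) 58179087 (n (n (s 58179119)
  58179120 e) 58179151 (n (s 58179152) 58180079 e))) 58180111 (n (n (n (s 58180112) 58180144 e)
  58180176 (n (s 58180177) 58211855 e)) 58212815 (n (n (s 58212846) 58212847 e) 58212911 (s
  58212912)))) 58212944 (n (n (n (n (s 58213839) 58213871 e) 58213872 (n (s 58213903) 58213904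
  e)) 58213935 (n (n (s 58213936) 58213968 e) 58214929 (s 58214961))) 58246607 (n (n (n (s
  58246638) 58246639 e) 58246704 (n (s 58247663) 58247664 e)) 58247695 (n (n (s 58247696)
  59195920 e) 59195952 (s 59195953))))) 59195985 (n (n (n (n (n (s 59196912) 59196977 e) 59197009
  (n (s 59227695) 59227727 e)) 59228655 (n (n (s 59228687) 59228719 e) 59228751 (n (s 59228752)
  59229679 e))) 59229680 (n (n (n (s 59229712) 59229744 e) 59229745 (n (s 59229776) 59229777 e))
  59230704 (n (n (s 59230737) 59230769 e) 59261422 (s 59261487)))) 59262446 (n (n (n (n (s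
  59262447) 59262479 e) 59262511 (n (s 59262544) 59263439 e)) 59263471 (n (n (s 59263472)
  59263503 e) 59263504 (s 59263536))) 59263537 (n (n (n (s 59264464) 59264496 e) 59264529 (n (s
  59296238) 59296239 e)) 59296271 (n (n (s 60244465) 60244496 e) 60244497 (s 60244529))))))
  60244561 (n (n (n (n (n (n (s 60245489) 60245521 e) 60245553 (n (s 60245554) 60276239 e))
  60276271 (n (n (s 60277231) 60277263 e) 60277264 (n (s 60277296) 60277328 e))) 60277329 (n (n
  (n (s 60278224) 60278256 e) 60278257 (n (s 60278288) 60278289 e)) 60278320 (n (n (s 60278321)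
  60278353 e) 60279248 (s 60279281)))) 60279313 (n (n (n (n (s 60279314) 60279346 e) 60309999 (n
  (s 60310031) 60310991 e)) 60311023 (n (n (s 60311055) 60311056 e) 60311088 (s 60311120)))
  60312015 (n (n (n (s 60312016) 60312047 e) 60312048 (n (s 60312049) 60312080 e)) 60312081 (n (n
  (s 60312112) 60312113 e) 60313040 (s 60313041))))) 60313073 (n (n (n (n (n (s 60313105)
  60344815 e) 60344848 (n (s 61292081) 61293073 e)) 61293105 (n (n (s 61293106) 61324815 e)
  61324847 (n (s 61324848) 61324879 e))) 61324880 (n (n (n (s 61325807) 61325808 e) 61325840 (n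
  (s 61325872) 61325873 e)) 61325904 (n (n (s 61325905) 61326800 e) 61326832 (s 61326833))))
  61326865 (n (n (n (n (s 61326897) 61326898 e) 61327857 (n (s 61327922) 61357615 e)) 61358574 (n
  (n (s 61358575) 61358607 e) 61358639 (s 61358640))) 61358672 (n (n (n (s 61359567) 61359599 e)
  61359600 (n (s 61359632) 61359664 e)) 61359665 (n (n (s 61359696) 61360592 e) 61360624 (s
  61360625))))))) 61360657 (n (n (n (n (n (n (n (s 61360689) 61361617 e) 61361649 (n (s 61392366)
  61392367 e)) 61392399 (n (n (s 61393391) 61393392 e) 61393424 (n (s 62341648) 62341680 e)))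
  62341681 (n (n (n (s 62341713) 62342640 e) 62342673 (n (s 62342705) 62373423 e)) 62374383 (n (n
  (s 62374415) 62374447 e) 62374480 (s 62375407)))) 62375408 (n (n (n (n (s 62375440) 62375472 e)
  62375473 (n (s 62375504) 62375505 e)) 62376400 (n (n (s 62376432) 62376433 e) 62376465 (s
  62376497))) 62377457 (n (n (n (s 62408174) 62408175 e) 62408207 (n (s 62408272) 62409167 e))
  62409199 (n (n (s 62409232) 62409264 e) 62410192 (s 62410224))))) 62410225 (n (n (n (n (n (s
  62410257) 62441967 e) 63420976 (n (s 63421968) 63422000 e)) 63422033 (n (n (s 63453743)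
  63454703 e) 63454735 (n (s 63454767) 63454768 e))) 63454800 (n (n (n (s 63455695) 63455727 e)
  63455728 (n (s 63455760) 63455792 e)) 63455793 (n (n (s 63455825) 63456752 e) 63456817 (s
  63488495)))) 63488527 (n (n (n (n (s 63488592) 63489487 e) 63489519 (n (s 63489520) 63489552
  e)) 63489584 (n (n (s 63490544) 63522287 e) 64469520 (s 64469552))) 64469553 (n (n (n (s
  64470512) 64470544 e) 64470545 (n (s 64470577) 64470609 e)) 64502255 (n (n (s 64502287)
  64503279 e) 64503280 (s 64503311)))))) 64503312 (n (n (n (n (n (n (s 64503344) 64503376 e)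
  64503377 (n (s 64504271) 64504272 e)) 64504304 (n (n (s 64504305) 64504336 e) 64504337 (n (s
  64504369) 64504401 e))) 64505296 (n (n (n (s 64505329) 64505361 e) 64505393 (n (s 64537039)
  64537071 e)) 64537104 (n (n (s 64537136) 64538063 e) 64538064 (s 64538096)))) 64538097 (n (n (n
  (n (s 64538128) 64538129 e) 65518096 (n (s 65518128) 65518129 e)) 65519153 (n (n (s 65549871)
  65550831 e) 65550863 (s 65550895))) 65550896 (n (n (n (s 65550928) 65551855 e) 65551856 (n (s
  65551888) 65551920 e)) 65551921 (n (n (s 65551953) 65552848 e) 65552880 (s 65552913)))))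
  65552945 (n (n (n (n (n (s 65552946) 65584623 e) 65584655 (n (s 65584720) 65585615 e)) 65585647
  (n (n (s 65585648) 65585680 e) 65585712 (n (s 65585713) 65586640 e))) 65586672 (n (n (n (s
  65586673) 65586705 e) 65618415 (n (s 65619439) 66566704 e)) 66567664 (n (n (s 66567696)
  66567728 e) 66567729 (s 66567761)))) 66568753 (n (n (n (n (s 66600431) 66600463 e) 66600528 (n
  (s 66601423) 66601455 e)) 66601456 (n (n (s 66601488) 66601520 e) 66601521 (s 66601553)))
  66602448 (n (n (n (s 66602480) 66602513 e) 66602545 (n (s 66634223) 66635215 e)) 66635247 (n (n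
  (s 66635248) 66635280 e) 66635312 (s 66636272))))))))))
end

section
open T
set_option maxRecDepth 20000 in
def treeG : T :=
  n (n (n (n (n (n (n (n (s 541200) 1589744 e) 1589745 (s 1589777)) 2637328 (n (n (s 2638353)
  2670096 e) 3654161 (s 3685904))) 3686928 (n (n (n (s 4735503) 4735567 e) 5784079 (s 5784080))
  5784111 (n (n (s 5784112) 6831664 e) 6831695 (s 6832655)))) 6832656 (n (n (n (n (s 6832687)
  6832688 e) 6864430 (s 6864431)) 7848464 (n (n (s 7848496) 7880207 e) 7880239 (s 7881231)))
  7881263 (n (n (n (s 7881264) 7881295 e) 8898064 (s 8930831)) 9946608 (n (s 9946640) 9978383 (s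
  9979407))))) 9979408 (n (n (n (n (n (s 10994192) 11026959 e) 11027984 (s 12043792)) 12076559 (n
  (n (s 13156879) 13157904 e) 14172656 (s 14172688))) 14204431 (n (n (n (s 14205424) 14205455 e)
  14205456 (s 14206448)) 14206480 (n (n (s 15220240) 15254032 e) 16268815 (s 16269840))))
  16302607 (n (n (n (n (s 16303632) 17318384 e) 17318385 (s 17318417)) 18366929 (n (n (s
  18366961) 19414513 e) 19415537 (s 19415538))) 19415569 (n (n (n (s 19447312) 20431345 e)
  20463088 (s 20463120)) 20464112 (n (s 20464113) 20464145 (s 21512719)))))) 21512720 (n (n (n (n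
  (n (n (s 21512751) 21512752 e) 22561264 (s 22561296)) 22561328 (n (n (s 23608848) 23608880 e)
  23608881 (s 23609840))) 23609871 (n (n (n (s 23609872) 23609904 e) 23641614 (s 23641615))
  24625680 (n (n (s 24625681) 24625712 e) 24625713 (s 24657423)))) 24657424 (n (n (n (n (s
  24657456) 24658416 e) 24658447 (s 24658448)) 24658479 (n (n (s 24658480) 25675248 e) 25675280
  (s 25707023))) 25708047 (n (n (n (s 25708048) 26723793 e) 26723825 (s 26724849)) 26756591 (n (s
  26756592) 26756624 (s 27771377))))) 27772401 (n (n (n (n (n (s 27804144) 27804175 e) 27804176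
  (s 27805168)) 27805169 (n (n (s 27805200) 27836943 e) 28788209 (s 28819984))) 28820976 (n (n (n
  (s 28820977) 28821008 e) 28822001 (s 28852751)) 28853775 (n (n (s 28853776) 29901296 e)
  29901328 (s 29933071)))) 29934064 (n (n (n (n (s 29934095) 29934096 e) 29935088 (s 29935120))
  30949872 (n (n (s 30949873) 30982640 e) 30982672 (s 30983664))) 31997425 (n (n (n (s 31997456)
  31998449 e) 32029199 (s 32030223)) 32030224 (n (s 32031217) 32031248 (s 33046000)))))))
  33046031 (n (n (n (n (n (n (n (s 33046032) 33047024 e) 33047025 (s 33047056)) 33048049 (n (n (s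
  33079824) 33080816 e) 33080848 (s 34094608))) 34095633 (n (n (n (s 34127376) 35143153 e)
  35144177 (s 35144178)) 35144209 (n (n (s 35175952) 36191761 e) 36224529 (s 37240336))))
  37240337 (n (n (n (n (s 37241361) 38288944 e) 38288975 (s 38289935)) 38289936 (n (n (s
  38289967) 38289968 e) 38321710 (s 38321711))) 39337488 (n (n (n (s 39337520) 39337521 e)
  39338480 (s 39338511)) 39338512 (n (s 39338544) 39370254 (s 39370255))))) 40386064 (n (n (n (n
  (n (s 40386096) 40386097 e) 40417839 (s 40418863)) 40418895 (n (n (s 41434640) 41434671 e)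
  41434672 (s 41434703))) 41435664 (n (n (n (s 41435696) 42451472 e) 42484239 (s 42485264))
  43500017 (n (n (s 43501041) 43532784 e) 43532815 (s 43532816)))) 43533808 (n (n (n (n (s
  43533809) 43533840 e) 43565583 (s 44581392)) 45597200 (n (n (s 45630992) 46677520 e) 46711312
  (s 47726065))) 47726096 (n (n (n (s 47727089) 47757839 e) 47758863 (s 47758864)) 47759857 (n (s
  47759888) 49823248 (s 49857040)))))) 50840081 (n (n (n (n (n (n (s 50871824) 50872848 e)
  51888625 (s 51920368)) 51920400 (n (n (s 51921392) 51921393 e) 51921425 (s 52968976))) 52968977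
  (n (n (n (s 52970001) 53984784 e) 53985809 (s 55034384)) 55034416 (n (n (s 55066127) 55066159
  e) 55067151 (s 55067183)))) 55067184 (n (n (n (n (s 55067215) 56082960 e) 56082961 (s
  56082992)) 56082993 (n (n (s 56114703) 56114704 e) 56114736 (s 56115696))) 56115727 (n (n (n (s
  56115728) 56115759 e) 56115760 (s 57163280)) 57163311 (n (s 57163312) 57163343 (s 57164304)))))
  57164336 (n (n (n (n (n (s 58179120) 58180112 e) 58180144 (s 58212911)) 58212912 (n (n (s
  59229712) 59262479 e) 60245489 (s 60277264))) 60278256 (n (n (n (s 60278257) 60278288 e)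
  60279281 (s 60310031)) 60311055 (n (n (s 60311056) 61325840 e) 61359632 (s 62375440))))
  63454735 (n (n (n (n (s 63455760) 63488527 e) 63489552 (s 64503280)) 64503311 (n (n (s
  64503312) 64504304 e) 64504305 (s 64504336))) 64505329 (n (n (n (s 64537104) 64538096 e)
  64538128 (s 65551888)) 65585680 (n (s 66567696) 66601488 (s 66635280)))))))
end

section
open T
set_option maxRecDepth 20000 in
def treeH : T :=
  n (n (n (n (n (n (n (n (n (s 1667001500144) 1667001500177 (s 2766513126928)) 2766513127953 (n
  (s 4965502829071) 4965537432143 (s 6065014456848))) 6065014456880 (n (n (s 6065049059855)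
  6065049059887 (s 7164526083632)) 7164526084624 (n (s 7164560686671) 8264037712399 (s
  8264072315439)))) 8264072315471 (n (n (n (s 9362509121040) 10462020748784 (s 10462020748816))
  10463095571983 (n (s 11561532375568) 11561532409360 (s 11562607198735))) 12661044004368 (n (n
  (s 12662118827535) 13761629439504 (s 14861141067248)) 18159674868208 (n (s 18159741977105)
  19259186495985 (s 19259253604817))))) 19259253604849 (n (n (n (n (s 20358698123761)
  20358765231601 (s 21458209751536)) 21458276860433 (n (s 22557721379343) 22557722427951 (s
  22557754933776))) 22557755982384 (n (n (s 23657233007120) 23657233007152 (s 23657234055728))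
  23657266561520 (n (s 23657267610096) 23657267610128 (s 24756744633904)))) 24756745683504 (n (n
  (n (s 24756778188304) 24756778188337 (s 24756779236880)) 24756779237872 (n (s 25856256262704)
  25856257311279 (s 25856289817072))) 25856289817104 (n (n (s 26954728752655) 26955768940047 (s
  26989087409648)) 28054240380399 (n (s 28054240380432) 28054272853457 e))))) 28054272853489 (n
  (n (n (n (n (s 28055279519216) 28055279519248 (s 28055280567791)) 28055280567824 (n (s
  28088599037425) 28088599038449 (s 29153752007183))) 29153752008208 (n (n (s 29153784480241)
  29188110665201 (s 30254303823375)) 30287622294001 (n (s 31319489298960) 31352774214160 (s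
  31352774247920)))) 31353814435312 (n (n (n (s 31353847955952) 31353847989744 (s
  32419000926704)) 32419000926736 (n (s 32452285841904) 32453359583729 (s 33518512553488)))
  33551797468688 (n (n (s 34618024148496) 34651309097456 (s 34652382839280)) 35718575963664 (n (s
  36852446282225) 37951957909009 e)))) 39017110846992 (n (n (n (n (s 39051469537809)
  40116588953135 (s 40150981164592)) 40150981165584 (n (s 41216100548112) 41216100548144 (s
  41216100580879))) 41250492792336 (n (n (s 41250492792369) 41250492793328 (s 42315612207663))
  42315612208687 (n (s 42350004420112) 42350004420145 (s 43415123803695)))) 43415157358128 (n (n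
  (n (s 43449516047920) 43449516048912 (s 44513595245071)) 44513595246096 (n (s 44547953902096)
  44547953934863 (s 44549028692496))) 44549028726288 (n (n (s 45613106872847) 45613106872848 (s
  45613106873840)) 45613106873872 (n (s 45647465563632) 45647465563664 e)))))) 46712618500624 (n
  (n (n (n (n (n (s 46746977190416) 46748051980816 (s 47812130129424)) 47846488819216 (n (s
  47847563575824) 48912715530768 (s 48947074220560))) 50012227124752 (n (n (s 50012227158544)
  52211250380304 (s 52211250414096)) 52245609070096 (n (s 52245609103888) 53379481485840 (s
  54477918290417)))) 54478993113584 (n (n (n (s 54478993113617) 55577429950993 (s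
  55578504740368)) 55578504741393 (n (s 56676941546001) 56678016335376 (s 57742060962351)))
  57742094515759 (n (n (s 57776454222384) 57777494441519 (s 57777494442511)) 57777494442543 (n (s
  58841572590095) 58841606143536 e)))) 58875965850128 (n (n (n (n (s 58875965850161)
  58877006069263 (s 58877006070287)) 58877006070288 (n (s 58877006070320) 59941084216879 (s
  59941084217904))) 59941117771312 (n (n (s 59975477510672) 59975477510704 (s 59976517697071))
  59976517697072 (n (s 59976517698064) 59976517698096 (s 59976551251504)))) 61040595845679 (n (n
  (n (s 61040629366320) 61040629400112 (s 61074989105680)) 61074989105712 (n (s 61076029325871)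
  61076029325872 (s 61076062846512))) 61076062880304 (n (n (s 62174500734480) 62174500767247 (s
  63238578882064)) 63274012361232 (n (s 63274012362224) 63274012362256 e))))) 64338090508816 (n
  (n (n (n (n (s 64373523989008) 64373524022800 (s 65473035617808)) 66537112747535 (n (s
  66537112782352) 66538187571727 (s 66538187572752))) 66572546228752 (n (n (s 66573621018127)
  66573621019152 (s 66573621052944)) 67636624410096 (n (s 67637699199504) 67637699200496 (s
  67637699200528)))) 67672057856496 (n (n (n (s 67673132646896) 67673132646928 (s
  68736136003088)) 68736136036880 (n (s 68737210827280) 68771569483280 (s 68772644273680)))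
  68772644307472 (n (n (s 69835647631888) 69835647665680 (s 69836722456080)) 69871081078288 (n (s
  69872155868688) 69872155902480 e)))) 70936200495632 (n (n (n (n (s 70936235098640)
  72035712123376 (s 72035712123409)) 72035746726384 (n (s 72035746726417) 73135223751185 (s
  73135258353168))) 75334214500943 (n (n (s 75334248055311) 75334248055375 (s 76433726128655))
  76433726128687 (n (s 76433759683087) 76433759683088 (s 76433759683119)))) 76433759683120 (n (n
  (n (s 77533237755471) 77533271309872 (s 77533271309903)) 77533271310864 (n (s 78632749384271)
  78632782938639 (s 78632782938703))) 79732294567439 (n (n (s 80830732453391) 80831806195215 (s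
  81931317821967)) 81931317822992 (n (s 81931351343632) 81931351377424 e))))))) 83030829450767 (n
  (n (n (n (n (n (n (s 83030862972432) 84095981371919 (s 84130340062736)) 84130374665744 (n (s
  85195492999664) 85195492999696 (s 85229851690480))) 85229852705264 (n (n (s 85229852705296)
  85229852739056 (s 85229852739088)) 85229886259696 (n (s 85229886259728) 85229886293488 (s
  85229886293520)))) 87394516221455 (n (n (n (s 87394516255247) 88528419045905 (s
  88528420094448)) 88528452600337 (n (s 88528453648880) 89627930673617 (s 89627930673649)))
  89627931722225 (n (n (s 89627964228049) 89627964228081 (s 89627965276657)) 90727442300401 (n (s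
  90727443350001) 90727475854833 e)))) 90727476904433 (n (n (n (n (s 90727476904465)
  92926433051183 (s 92926433051184)) 92926466605583 (n (s 92926466605616) 92926500160015 (s
  92926500160016))) 94025944678896 (n (n (s 94025944678928) 94025944678960 (s 94025978233328))
  94025978233392 (n (s 94026011787760) 94026011787792 (s 94026011787824)))) 95125456306736 (n (n
  (n (s 95125489860112) 95125489861104 (s 95125523414577)) 95125523415568 (n (s 96225001488944)
  97323439343088 (s 97323439375887))) 97323472897520 (n (n (s 97323473978895) 97324479563279 (s
  97357798032880)) 98422950970865 (n (s 98422951003631) 98422951003664 e))))) 98422984525297 (n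
  (n (n (n (n (s 98422984558064) 98422984558096 (s 98422985606639)) 98422985606672 (n (s
  98423991191023) 98423991191056 (s 98424024745456))) 98424024745488 (n (n (s 98424058299888)
  98424058299920 (s 98457309660657)) 98457309661681 (n (s 99522462630415) 99522462631440 (s
  99522497233423)))) 99522497234448 (n (n (n (s 99523502818800) 99556821288433 (s
  100623014446607)) 100656332917233 (n (s 101688199922192) 101688234525200 (s 101721484871152)))
  101721519440400 (n (n (s 101722558579184) 101722558612976 (s 101722559661552)) 101722593215984
  (n (s 102787711549936) 102787711549968 e)))) 102787746152944 (n (n (n (n (s 102787746152976)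
  102822070206961 (s 103887223176720)) 103887257779728 (n (s 103920542694928) 104986734771728 (s
  104986769374736))) 105020019720688 (n (n (s 105021093462512) 105021128065520 (s
  106087286586896)) 106087320141328 (n (s 106121678832145) 107221190458865 (s 107221190459889))))
  108286309842449 (n (n (n (s 108286343396881) 108320702086673 (s 108320703135249))
  109385821470224 (n (s 109385821471249) 109385855025681 (s 109420213715473))) 109420214764049 (n
  (n (s 110485300592207) 110485334146639 (s 110485334179375)) 110486407921199 (n (s
  110519691787824) 110519691788816 e)))))) 110519692837391 (n (n (n (n (n (n (s 110519726390832)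
  110519726391823 (s 110519726391824)) 111584845774352 (n (s 111584845774384) 111584845807119 (s
  111585919548943))) 111619203415568 (n (n (s 111619203415601) 111619203416560 (s
  111619204464176)) 111619204465168 (n (s 111619204465200) 111619238018576 (s 111619238018608))))
  111619238018609 (n (n (n (s 111619238019568) 111619238019600 (s 111619238019632))
  112684323880527 (n (s 112684357433903) 112684357434927 (s 112684357434959))) 112685431175727 (n
  (n (s 112718715043344) 112718715043377 (s 112718716091920)) 112718716091952 (n (s
  112718749646352) 112718749646384 e)))) 112718749646385 (n (n (n (n (s 113783835475535)
  113783869029935 (s 113783869029967)) 113818226671152 (n (s 113818226672144) 113818227720720 (s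
  113818227720752))) 113818261274160 (n (n (s 113818261275152) 113818261275184 (s
  114916698079760)) 114916699128336 (n (s 114917739315728) 114917739348495 (s 114917772870160))))
  114917772902927 (n (n (n (s 115981818544655) 116016209707505 (s 116016210789872))
  116016210789904 (n (s 116017250976272) 116017250977265 (s 116017252025840))) 116017252025872 (n
  (n (s 116017284530704) 116017284531697 (s 116017284531728)) 117116796158480 (n (s
  119280385966608) 119281426154000 e))))) 119281459674640 (n (n (n (n (n (s 119281459708432)
  120380937747984 (s 120380937781776)) 120415330025969 (n (s 122579994557968) 123748192109072 (s
  124812270256625))) 124812270256657 (n (n (s 124812303811057) 124812303811089 (s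
  124846629962225)) 124846663516657 (n (s 124847703736816) 124847703736817 (s 124847703736849))))
  124847737291249 (n (n (n (s 124847737291281) 125911815438865 (s 125946175177233))
  125947215363600 (n (s 125947215364625) 125947248919057 (s 127011327033873))) 127045686772241 (n
  (n (s 127046726958608) 127046726959633 (s 127046760514065)) 128110805138991 (n (s
  128110806188591) 128145164845616 e)))) 128145198400048 (n (n (n (n (s 129210317816335)
  129244676473360 (s 129244676473393)) 129244710027792 (n (s 129244710027825) 130309828394544 (s
  130309829443119))) 130309829444144 (n (n (s 130344188133904) 130344188133936 (s
  130344221688336)) 130345261874736 (n (s 131409339989552) 131409340023344 (s 131409341071919))))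
  131443699728912 (n (n (n (s 131443699728944) 131443733283344 (s 131444773469744))
  131444773503536 (n (s 132507811431952) 132543244912144 (s 133607323059696))) 133642724066831 (n
  (n (s 133642756539888) 134706834686480 (s 134742268200464)) 135841779795472 (n (s
  136906898194959) 136906898195984 e)))))))) 136906931750416 (n (n (n (n (n (n (n (n (s
  136941291454992) 136942331641359 (s 136942331642384)) 136942365196816 (n (s 138006409789936)
  138006409822736 (s 138006409823728))) 138006409823760 (n (n (s 138006443378160) 138040803082736
  (s 138041843270128)) 138041843270160 (n (s 138041876824560) 139105921450512 (s
  139141354896912)))) 139141388451344 (n (n (n (s 140205433045520) 140205466633744 (s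
  140240900046352)) 141303904485904 (n (s 141304979276304) 142403416113681 (s 142404490904048)))
  143502927740432 (n (n (s 143502927741457) 143504002530832 (s 143504002531857)) 144602439336465
  (n (s 144603514159632) 145701918491215 e)))) 145702992232975 (n (n (n (n (s 146801430118927)
  146801430118959 (s 146802503860752)) 146802503860784 (n (s 146802537415216) 147900941745743 (s
  147902015488528))) 147902015520303 (n (n (s 147902049041968) 147902049074735 (s
  149001527115311)) 149001527116303 (n (s 149001527116335) 149001560669743 (s 150099998557711))))
  151199510152688 (n (n (n (s 151199510152720) 151199510185487 (s 151199510185488))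
  152299021779472 (n (s 152299021812239) 152299021813264 (s 153398533408272))) 153398533441039 (n
  (n (s 154498044053008) 154499118842383 (s 154499118843408)) 155597555680752 (n (s
  155598630437392) 155598630470160 e))))) 155598630471152 (n (n (n (n (n (s 155598630471184)
  156698142064144 (s 156698142097936)) 157797653691919 (n (s 157797653692944) 157797653725711 (s
  157797653726736))) 158896124084720 (n (n (s 158896156590609) 158897164272112 (s
  159995635712497)) 159995668218321 (n (s 159995668218353) 159996675899889 (s 161095147340305))))
  161095179845105 (n (n (n (s 161096187527665) 161129506030065 (s 161129506030097))
  162194691473937 (n (s 162195699155440) 162229017625073 (s 163294137041455))) 163294137041456 (n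
  (n (s 163294170595855) 163294171644463 (s 163295177228848)) 163295244337680 (n (s
  164393648669200) 164393683272240 e)))) 164394688856592 (n (n (n (n (s 164394722411056)
  164394755965424 (s 165493160295952)) 165493160295984 (n (s 165493160296944) 165493160297008 (s
  165493193850384))) 165493193851376 (n (n (s 165493193851408) 165493194900016 (s
  165494200483344)) 165494200483376 (n (s 165494200516111) 165494234037808 (s 165494267592208))))
  165494267592241 (n (n (n (s 165527518986736) 166592671924783 (s 166592671924784))
  166592705446449 (n (s 166592705479184) 166593712111119 (s 166593712112144))) 166593712112176 (n
  (n (s 166593745666608) 166593779220016 (s 166593779220976)) 166593779221008 (n (s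
  167692183553551) 167692218156559 e)))))) 167725502023152 (n (n (n (n (n (n (s 167726575764976)
  168791695181295 (s 168791695181296)) 168791695181328 (n (s 168791728735728) 168791728735760 (s
  168791729784303))) 168791729784336 (n (n (s 168825013650929) 168825013651953 (s
  168826087392753)) 168826120947153 (n (s 168826120947185) 169891206809072 (s 169891241411087))))
  169924525278705 (n (n (n (s 169925599020529) 170990718404080 (s 171024036907505))
  171025110649329 (n (s 172090262569456) 172090262603248 (s 172090263618064))) 172090263651824 (n
  (n (s 172090263651856) 172091303838224 (s 172091303839216)) 172091337359856 (n (s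
  172091337392656) 172091337393648 e)))) 173189774197233 (n (n (n (n (s 173189775245808)
  173189775279600 (s 173190815465968)) 173190815466000 (n (s 173190848987633) 173190849020400 (s
  174289286872592))) 174289286906384 (n (n (s 174290327092752) 174290360647184 (s
  175388797452784)) 175388798501360 (n (s 175388798501392) 175388798535152 (s 175388798535184))))
  175389838687760 (n (n (n (s 175389838688752) 175389838722544 (s 175389872242192))
  175389872243184 (n (s 176454990577168) 176489349267985 (s 176490424057360))) 177554502205969 (n
  (n (s 177588860895729) 177589935686129 (s 177589935686161)) 178654013832721 (n (s
  178688372522513) 178689447312913 e))))) 179753525461521 (n (n (n (n (n (s 179787884151313)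
  179788958941713 (s 180853004582479)) 180854078357039 (n (s 180887395778096) 180888470568496 (s
  181953589984783))) 181986907405840 (n (n (s 181986907405873) 181987948642800 (s
  181987982196240)) 181987982196273 (n (s 183053101611567) 183053101612591 (s 183086419033649))))
  183087460269584 (n (n (n (s 184152613207599) 184185930661424 (s 184186971897392))
  184186971898384 (n (s 184187005451824) 185285443306000 (s 185285443338767))) 185285443339792 (n
  (n (s 186384954967568) 188583978189328 (s 188583978223120)) 189649130110480 (n (s
  189649130144272) 189684563624464 e)))) 190748641738256 (n (n (n (n (s 190784075252240)
  192947664993808 (s 192947665027600)) 192983098474000 (n (s 192983098507792) 196279485874705 (s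
  196314919354897))) 197378997469713 (n (n (s 197414430949905) 198478509129263 (s
  198512868835888)) 199578020757040 (n (s 199612380463632) 199612380463665 (s 200677532384816))))
  200711892124176 (n (n (n (s 200711892124208) 200712965865008 (s 201777043979824))
  201777044013616 (n (s 201811403719184) 201811403719216 (s 201812477460016))) 201812477493808 (n
  (n (s 207274602151439) 207274602185231 (s 207274602186256)) 207310035631631 (n (s
  207310035632656) 207310035666448 e))))))) 208374113814000 (n (n (n (n (n (n (n (s
  208374113814032) 208409547260400 (s 209473625406992)) 209473625440784 (n (s 209509058887184)
  209509058920976 (s 210573137002000))) 210573137035792 (n (n (s 210573137069584) 210608570482192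
  (s 210608570515984)) 210608570549776 (n (s 213838386970128) 213872745660945 (s
  214937898598928)))) 214972257255953 (n (n (n (s 216071735362063) 216071769965135 (s
  218236399959599)) 218270758617616 (n (s 218270793219663) 219335911554607 (s 219335911555631)))
  220468741654032 (n (n (s 220469816477199) 221568253281776 (s 221569328072176)) 221569328072208
  (n (s 221569328104975) 221569328104976 e)))) 222668839698960 (n (n (n (n (s 222668839731727)
  222668839732752 (s 223768351327760)) 223768351360527 (n (s 224832428492304) 224833503281679 (s
  225931940120048))) 225933014876688 (n (n (s 225933014909456) 225933014910448 (s
  225933014910480)) 227032526503440 (n (s 227032526537232) 228132038131215 (s 228132038132240))))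
  228132038165007 (n (n (n (s 228132038166032) 229265907401200 (s 229265940955665))
  229265974510097 (n (s 230365419028977) 230365486137809 (s 230365486137841))) 231463890469361 (n
  (n (s 231463890469393) 231464930656753 (s 231464964211185)) 232563402064369 (n (s
  232564475806193) 233663921406511 e))))) 233663954960943 (n (n (n (n (n (s 233663987466768)
  233663988515343 (s 234763500143120)) 235828653080112 (n (s 235861903426032) 235861938029104 (s
  235862944662064))) 235862978215472 (n (n (s 235862978216432) 235862978216496 (s
  235863010721296)) 235863011769872 (n (s 235863011770864) 235863011770896 (s 236928163659312))))
  236928164708912 (n (n (n (s 236961449624112) 236962489844272 (s 236962523365937))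
  236962523398672 (n (s 236962523398704) 238060960204272 (s 238060961252880))) 238060961285647 (n
  (n (s 238062001473039) 239160471832049 (s 239160472913391)) 239160472913424 (n (s
  239160505386449) 239160505386481 e)))) 239161513100783 (n (n (n (n (s 239161513100784)
  239161513100816 (s 239161546655216)) 239161546655248 (n (s 240259983459825) 240259984540175 (s
  240259984541168))) 240259984541200 (n (n (s 240261024728560) 241359495088625 (s
  241359496136176)) 241359496136208 (n (s 241360536323568) 242424648057360 (s 242424648091152))))
  242425688277520 (n (n (n (s 242425721831952) 242460080488944 (s 242460080522736))
  242460081537552 (n (s 242460081571312) 242460081571344 (s 243524159685104))) 243524159718896 (n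
  (n (s 243525199905264) 243525199905296 (s 243525233459696)) 243559592116721 (n (s
  243559593165296) 243559593199088 e)))))) 244623671311888 (n (n (n (n (n (n (s 244623671345680)
  244624711532048 (s 244624745086480)) 244659104792080 (n (s 244659104825872) 245723182940688 (s
  245723182974448))) 245723182974480 (n (n (s 245724223127056) 245724223128048 (s
  245724223161840)) 245724256681488 (n (s 245758615372272) 245758616420848 (s 245758616420880))))
  245758616454640 (n (n (n (s 245758616454672) 246824808496656 (s 246859167187473))
  247924320125457 (n (s 247958678815217) 249023831752209 (s 249058190442001))) 250123343381009 (n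
  (n (s 250157702070801) 251223896276527 (s 251257213698576)) 252323407904271 (n (s
  252356725326320) 253421844708880 e)))) 253422919531055 (n (n (n (n (s 253422919532079)
  254521356336688 (s 254521356337680)) 254521389891120 (n (s 254522431127087) 255619827779088 (s
  255655261225488))) 255655261258255 (n (n (s 257818851033616) 257854284513808 (s
  258918362628624)) 258918362662416 (n (s 258953796108816) 258953796142608 (s 260018948063760))))
  261118459691536 (n (n (n (s 263317482913296) 263317482947088 (s 265548717343217))
  265584150823409 (n (s 266648229003793) 266649303794193 (s 266683662483985))) 266684737274385 (n
  (n (s 267747740598801) 267748815389201 (s 267783174078993)) 267784248869393 (n (s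
  268847253275184) 268848293494319 e))))) 268848293495343 (n (n (n (n (n (s 269946764902928)
  269946764902961 (s 269947805122063)) 269947805123087 (n (s 269947805123120) 271046276563472 (s
  271046276563504))) 271047316749871 (n (n (s 271047316749872) 271047316750864 (s
  271047316750896)) 271047350304304 (n (s 271082750230064) 271082750231056 (s 271082783784496))))
  272145788158480 (n (n (n (s 272145788158512) 272146828345872 (s 272146828378671))
  272146828378672 (n (s 272146861899312) 272146861933104 (s 272182261825072))) 272182261826064 (n
  (n (s 272182261858864) 272182295379504 (s 272182295413296)) 273245299787280 (n (s
  273245299820047) 273280733267472 e)))) 273280733300239 (n (n (n (n (s 274344811415056)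
  275444323041808 (s 275444323075600)) 275479756522000 (n (s 275479756555792) 276543834670608 (s
  276579268150800))) 277608986624527 (n (n (s 277608986625552) 277644420070927 (s
  277644420105744)) 277679853551119 (n (s 277679853552144) 278708498253328 (s 278743931699696))))
  278779365179920 (n (n (n (s 279808009846288) 279808009880080 (s 279843443326480))
  279843443360272 (n (s 279878876806672) 279878876840464 (s 280907521441296))) 280907521475088 (n
  (n (s 280907521508880) 280942954921488 (s 280942954989072)) 280978388401680 (n (s
  280978388435472) 280978388469264 e))))))))
end

/-- The quadratic form. -/
def Q (a b c d : ℤ) : ℤ :=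
  a * (19200 * a + -21920 * b + -22560 * c + 19480 * d) +
  b * (-1904 * b + 15656 * c + 3154 * d) +
  c * (9504 * c + -32828 * d) +
  d * (10655 * d)

theorem Q_step_rat (a b c d p q : ℚ) :
    (19200) * ((a + d + p) * (a + d + p)) + (-21920) * ((a + d + p) * (c + d)) + (-22560) * ((a + d + p) * (a + b)) + (19480) * ((a + d + p) * (b + q)) + (-1904) * ((c + d) * (c + d)) + (15656) * ((c + d) * (a + b)) + (3154) * ((c + d) * (b + q)) + (9504) * ((a + b) * (a + b)) + (-32828) * ((a + b) * (b + q)) + (10655) * ((b + q) * (b + q)) ≤ 5 / 8 * ((19200) * (a * a) + (-21920) * (a * b) + (-22560) * (a * c) + (19480) * (a * d) + (-1904) * (b * b) + (15656) * (b * c) + (3154) * (b * d) + (9504) * (c * c) + (-32828) * (c * d) + (10655) * (d * d)) +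
    ((174194200) * (p * p) + (150396980) * (p * q) + (144950230) * (q * q)) / 2899 := by
  linear_combination (1 / 23424) * sq_nonneg ((11712) * a + (3200) * b + (-7836) * c + (2599) * d + (-15840) * p + (13348) * q) +
    (1 / 23665934784) * sq_nonneg ((16165256) * b + (-5039100) * c + (-10591205) * d + (5422560) * p + (5761576) * q) +
    (5 / 3469999148871131008) * sq_nonneg ((53664463292) * c + (15771391953) * d + (88141656160) * p + (53217057476) * q) +
    (5 / 3396360806228488611586568) * sq_nonneg ((63288824631454) * d + (-65028171643000) * p + (-122665400420365) * q) +
    (1 / 3875936901176311794703157597970096928) * sq_nonneg ((211252303244192795680) * p + (99145023260162871271) * q) +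
    (192044373973973275300519197 / 122484085420982982935264) * sq_nonneg ((1) * q)
/-- Key of an integer vector. -/
def keyD (a b c d : ℤ) : ℕ :=
  ((a + 16) + 32 * (b + 16) + 1024 * (c + 16) + 32768 * (d + 16)).toNat

def inb (a b c d : ℤ) : Bool :=
  Nat.blt a.natAbs 16 && (Nat.blt b.natAbs 16 && (Nat.blt c.natAbs 16 && Nat.blt d.natAbs 16))

noncomputable def memS (a b c d : ℤ) : Bool := mem treeS (keyD a b c d) && inb a b c d

noncomputable def mem3 (t : T) (u v w : ℕ) (a b c d : ℤ) : Bool :=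
  mem t (keyD a b c d + 1048576 * (u + 4 * v + 16 * w)) &&
    (inb a b c d && (Nat.blt u 4 && (Nat.blt v 4 && Nat.blt w 4)))

noncomputable def memH (u v w x : ℕ) (a b c d a' b' c' d' : ℤ) : Bool :=
  mem treeH (keyD a b c d + 1048576 * keyD a' b' c' d' +
    1099511627776 * (u + 4 * v + 16 * w + 64 * x)) &&
    (inb a b c d && (inb a' b' c' d' &&
      (Nat.blt u 4 && (Nat.blt v 4 && (Nat.blt w 4 && Nat.blt x 4)))))

/-- Coordinate number of a key, shifted. -/
def dec (k m : ℕ) : ℤ := Int.ofNat (k / m % 32) - 16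

/-- Transitions: index of letter to (index of letter in image, Parikh vector of what precedes it,
coordinates 0 and 4). -/
def TR (u : ℕ) : List (ℕ × ℤ × ℤ) :=
  match u with
  | 0 => [(0, 0, 0), (2, 1, 0)]
  | 1 => [(3, 0, 0), (2, 0, 1)]
  | 2 => [(1, 0, 0)]
  | _ => [(0, 0, 0), (1, 1, 0)]

noncomputable def imp (a b : Bool) : Bool := sel a b true

def RR : List (ℤ × ℤ) := [(0, 0), (1, 0), (0, 1)]

/-- Second differences of elements of RR. -/
def DD : List (ℤ × ℤ) :=
  [(0, 0), (1, 0), (0, 1), (2, 0), (0, 2), (1, 1), (-2, 0), (-1, 0), (-2, 1), (-2, 2), (-1, 1),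
   (0, -2), (0, -1), (1, -2), (2, -2), (1, -1)]

/-- Forces evaluation of an integer before it is substituted. -/
noncomputable def force (x : ℤ) (f : ℤ → Bool) : Bool :=
  Int.rec (motive := fun _ => Bool)
    (fun n => Nat.rec (motive := fun _ => Bool) (f (Int.ofNat 0))
      (fun m _ => f (Int.ofNat (Nat.succ m))) n)
    (fun n => Nat.rec (motive := fun _ => Bool) (f (Int.negSucc 0))
      (fun m _ => f (Int.negSucc (Nat.succ m))) n) x

theorem force_eq (x : ℤ) (f : ℤ → Bool) : force x f = f x := by
  rcases x with n | n <;> cases n <;> rfl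

noncomputable def force4 (a b c d : ℤ) (f : ℤ → ℤ → ℤ → ℤ → Bool) : Bool :=
  force a fun a => force b fun b => force c fun c => force d fun d => f a b c d

theorem force4_eq (a b c d : ℤ) (f : ℤ → ℤ → ℤ → ℤ → Bool) : force4 a b c d f = f a b c d := by
  simp only [force4, force_eq]

noncomputable def chS1 (a b c d : ℤ) : Bool :=
  sel (memS a b c d) true (decide (640935 < Q a b c d))

noncomputable def chS (a b c d : ℤ) : Bool :=
  DD.all fun r =>
    force4 (c - (d - r.2)) (d - r.2) (-(a - r.1) + b + c - (d - r.2)) ((a - r.1) - c + (d - r.2))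
      chS1

noncomputable def checkS (k : ℕ) : Bool :=
  force4 (dec k 1) (dec k 32) (dec k 1024) (dec k 32768) chS

def isK (a b c d : ℤ) : Bool := decide (a + b + c + d = 0) && decide (b + 3 * c + 4 * d = 0)

noncomputable def chF1 (u v w : ℕ) (par : Bool) (a b c d : ℤ) : Bool :=
  sel (imp (memS a b c d) (mem3 treeF u v w a b c d)) (imp (mem3 treeG u v w a b c d) par) false

noncomputable def chF (u v w : ℕ) (a b c d : ℤ) : Bool :=
  imp (isK a b c d) (mem3 treeG u v w a b c d) &&
  (TR u).all fun x => (TR v).all fun y => (TR w).all fun z =>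
    force4 (a + d + (x.2.1 - 2 * y.2.1 + z.2.1)) (c + d) (a + b)
      (b + (x.2.2 - 2 * y.2.2 + z.2.2))
      (chF1 x.1 y.1 z.1 (mem3 treeG u v w a b c d))

noncomputable def checkF (k : ℕ) : Bool :=
  force4 (dec k 1) (dec k 32) (dec k 1024) (dec k 32768)
    (chF (k / 1048576 % 4) (k / 4194304 % 4) (k / 16777216 % 4))

noncomputable def checkG (k : ℕ) : Bool := memS (dec k 1) (dec k 32) (dec k 1024) (dec k 32768)

/-- One step of quadruples. -/
noncomputable def chH0 (u v w x : ℕ) (a b c d a' b' c' d' : ℤ) : Bool :=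
  imp (mem3 treeG u v w a b c d) (imp (mem3 treeG v w x a' b' c' d')
    (memH u v w x a b c d a' b' c' d'))

noncomputable def chH1 (x y z t : ℕ × ℤ × ℤ) (a b c d a' b' c' d' : ℤ) : Bool :=
  force4 (a + d + (x.2.1 - 2 * y.2.1 + z.2.1)) (c + d) (a + b) (b + (x.2.2 - 2 * y.2.2 + z.2.2))
    fun a b c d =>
  force4 (a' + d' + (y.2.1 - 2 * z.2.1 + t.2.1)) (c' + d') (a' + b')
        (b' + (y.2.2 - 2 * z.2.2 + t.2.2)) (chH0 x.1 y.1 z.1 t.1 a b c d)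

noncomputable def chH (u v w x : ℕ) (a b c d a' b' c' d' : ℤ) : Bool :=
  imp (isK a b c d) (!(isK a' b' c' d')) &&
  (TR u).all fun x₀ => (TR v).all fun x₁ => (TR w).all fun x₂ => (TR x).all fun x₃ =>
    chH1 x₀ x₁ x₂ x₃ a b c d a' b' c' d'

noncomputable def checkH (k : ℕ) : Bool :=
  chH (k / 1099511627776 % 4) (k / 4398046511104 % 4) (k / 17592186044416 % 4)
    (k / 70368744177664 % 4)
    (dec k 1) (dec k 32) (dec k 1024) (dec k 32768)
    (dec k 1048576) (dec k 33554432) (dec k 1073741824) (dec k 34359738368)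

noncomputable def checkSeeds : Bool :=
  [0, 1, 2, 3].all fun u =>
    (TR u).all fun x₀ => (TR u).all fun x₁ => (TR u).all fun x₂ => (TR u).all fun x₃ =>
      (decide (x₀.2 = x₁.2) && (decide (x₁.2 = x₂.2) && decide (x₂.2 = x₃.2))) ||
        chH1 x₀ x₁ x₂ x₃ 0 0 0 0 0 0 0 0

noncomputable def checkK : Bool :=
  (List.range 21).all fun i => (List.range 21).all fun j =>
    force4 (2 * (Int.ofNat i - 10) + 3 * (Int.ofNat j - 10))
      (-3 * (Int.ofNat i - 10) - 4 * (Int.ofNat j - 10)) (Int.ofNat i - 10) (Int.ofNat j - 10) chS1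



theorem allG : allT checkG treeG = true := by decide +kernel
theorem allSeeds : checkSeeds = true := by decide +kernel
theorem allK : checkK = true := by decide +kernel
theorem allS : allT checkS treeS = true := by decide +kernel
theorem allF : allT checkF treeF = true := by decide +kernel
theorem allH : allT checkH treeH = true := by decide +kernel

theorem inb_iff (a b c d : ℤ) : inb a b c d = true ↔
    a.natAbs < 16 ∧ b.natAbs < 16 ∧ c.natAbs < 16 ∧ d.natAbs < 16 := by
  simp only [inb, Bool.and_eq_true, Nat.blt_eq]

theorem dec_key {a b c d : ℤ} (h : inb a b c d = true) (m : ℕ) :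
    dec (keyD a b c d + 1048576 * m) 1 = a ∧ dec (keyD a b c d + 1048576 * m) 32 = b ∧
    dec (keyD a b c d + 1048576 * m) 1024 = c ∧ dec (keyD a b c d + 1048576 * m) 32768 = d := by
  rw [inb_iff] at h
  simp only [dec, keyD, Int.ofNat_eq_natCast]
  refine ⟨?_, ?_, ?_, ?_⟩ <;> omega

theorem key_lt {a b c d : ℤ} (h : inb a b c d = true) : keyD a b c d < 1048576 := by
  rw [inb_iff] at h
  simp only [keyD]
  omega

theorem imp_iff (a b : Bool) : imp a b = true ↔ (a = true → b = true) := by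
  cases a <;> cases b <;> simp [imp, sel_eq]

theorem sel_or (a b : Bool) : sel a true b = true ↔ (a = true ∨ b = true) := by
  cases a <;> cases b <;> simp [sel_eq]

theorem sel_and (a b : Bool) : sel a b false = true ↔ (a = true ∧ b = true) := by
  cases a <;> cases b <;> simp [sel_eq]

theorem memS_inb {a b c d : ℤ} (h : memS a b c d = true) : inb a b c d = true := by
  simp only [memS, Bool.and_eq_true] at h
  exact h.2

theorem memS_ch {a b c d : ℤ} (h : memS a b c d = true) : chS a b c d = true := by
  have hi := memS_inb h
  simp only [memS, Bool.and_eq_true] at h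
  have h1 := allT_mem allS h.1
  obtain ⟨e1, e2, e3, e4⟩ := dec_key hi 0
  simp only [Nat.mul_zero, Nat.add_zero] at e1 e2 e3 e4
  rw [checkS, force4_eq, e1, e2, e3, e4] at h1
  exact h1

theorem memF_ch {u v w : ℕ} {a b c d : ℤ} (h : mem3 treeF u v w a b c d = true) :
    chF u v w a b c d = true := by
  simp only [mem3, Bool.and_eq_true, Nat.blt_eq] at h
  obtain ⟨h0, hi, hu, hv, hw⟩ := h
  have h1 := allT_mem allF h0
  obtain ⟨e1, e2, e3, e4⟩ := dec_key hi (u + 4 * v + 16 * w)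
  have hk := key_lt hi
  rw [checkF, force4_eq, e1, e2, e3, e4] at h1
  convert h1 using 1
  generalize keyD a b c d = k at hk
  congr 1 <;> omega

theorem memG_S {u v w : ℕ} {a b c d : ℤ} (h : mem3 treeG u v w a b c d = true) :
    memS a b c d = true := by
  simp only [mem3, Bool.and_eq_true, Nat.blt_eq] at h
  obtain ⟨h0, hi, hu, hv, hw⟩ := h
  have h1 := allT_mem allG h0
  obtain ⟨e1, e2, e3, e4⟩ := dec_key hi (u + 4 * v + 16 * w)
  rw [checkG, e1, e2, e3, e4] at h1
  exact h1

theorem dec_div (k m m' : ℕ) : dec k (m * m') = dec (k / m) m' := by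
  simp only [dec, Nat.div_div_eq_div_mul]

theorem memH_ch {u v w x : ℕ} {a b c d a' b' c' d' : ℤ}
    (h : memH u v w x a b c d a' b' c' d' = true) :
    chH u v w x a b c d a' b' c' d' = true := by
  simp only [memH, Bool.and_eq_true, Nat.blt_eq] at h
  obtain ⟨h0, hi, hi', hu, hv, hw, hx⟩ := h
  have h1 := allT_mem allH h0
  have hk := key_lt hi
  have hk' := key_lt hi'
  obtain ⟨e1, e2, e3, e4⟩ := dec_key hi (keyD a' b' c' d' +
    1048576 * (u + 4 * v + 16 * w + 64 * x))
  obtain ⟨f1, f2, f3, f4⟩ := dec_key hi' (u + 4 * v + 16 * w + 64 * x)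
  have hkk : keyD a b c d + 1048576 * keyD a' b' c' d' +
      1099511627776 * (u + 4 * v + 16 * w + 64 * x) =
      keyD a b c d + 1048576 * (keyD a' b' c' d' + 1048576 * (u + 4 * v + 16 * w + 64 * x)) := by
    ring
  have hd : (keyD a b c d + 1048576 * (keyD a' b' c' d' +
      1048576 * (u + 4 * v + 16 * w + 64 * x))) / 1048576 =
      keyD a' b' c' d' + 1048576 * (u + 4 * v + 16 * w + 64 * x) := by omega
  rw [hkk, checkH, e1, e2, e3, e4, show 1048576 = 1048576 * 1 from rfl,
    show 33554432 = 1048576 * 32 from rfl, show 1073741824 = 1048576 * 1024 from rfl,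
    show 34359738368 = 1048576 * 32768 from rfl, dec_div, dec_div, dec_div, dec_div] at h1
  simp only [Nat.mul_one] at h1
  rw [hd, f1, f2, f3, f4] at h1
  convert h1 using 1
  generalize keyD a b c d = k at hk
  generalize keyD a' b' c' d' = k' at hk'
  congr 1 <;> omega

theorem TR_mem {a : ℕ} {r : ℕ × ℤ × ℤ} (h : r ∈ TR a) :
    (r.2.1 = 0 ∧ r.2.2 = 0) ∨ (r.2.1 = 1 ∧ r.2.2 = 0) ∨ (r.2.1 = 0 ∧ r.2.2 = 1) := by
  unfold TR at h
  split at h <;> simp only [List.mem_cons, List.not_mem_nil, or_false] at h <;>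
    rcases h with rfl | rfl <;> simp

theorem DD_mem {a b c : ℕ} {x y z : ℕ × ℤ × ℤ} (hx : x ∈ TR a) (hy : y ∈ TR b) (hz : z ∈ TR c) :
    (x.2.1 - 2 * y.2.1 + z.2.1, x.2.2 - 2 * y.2.2 + z.2.2) ∈ DD := by
  rcases TR_mem hx with ⟨h1, h2⟩ | ⟨h1, h2⟩ | ⟨h1, h2⟩ <;>
  rcases TR_mem hy with ⟨h3, h4⟩ | ⟨h3, h4⟩ | ⟨h3, h4⟩ <;>
  rcases TR_mem hz with ⟨h5, h6⟩ | ⟨h5, h6⟩ | ⟨h5, h6⟩ <;>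
  rw [h1, h2, h3, h4, h5, h6] <;> decide

theorem Q_step {a b c d p q : ℤ} (hpq : (p, q) ∈ DD) (h : Q a b c d ≤ 640935) :
    Q (a + d + p) (c + d) (a + b) (b + q) ≤ 640935 := by
  have h1 := Q_step_rat a b c d p q
  have h2 : 8 * 2899 * Q (a + d + p) (c + d) (a + b) (b + q) ≤
      5 * 2899 * Q a b c d + 8 * (174194200 * (p * p) + 150396980 * (p * q) +
        144950230 * (q * q)) := by
    have : (8 * 2899 * Q (a + d + p) (c + d) (a + b) (b + q) : ℚ) ≤
      5 * 2899 * Q a b c d + 8 * (174194200 * (p * p) + 150396980 * (p * q) +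
        144950230 * (q * q)) := by
      simp only [Q]
      push_cast
      linarith
    exact_mod_cast this
  have h3 : 174194200 * (p * p) + 150396980 * (p * q) + 144950230 * (q * q) ≤ 696776800 := by
    have : ∀ r ∈ DD, 174194200 * (r.1 * r.1) + 150396980 * (r.1 * r.2) + 144950230 * (r.2 * r.2)
      ≤ 696776800 := by decide
    exact this _ hpq
  omega

/-! ### The word -/

def phi (u : ℕ) : List ℕ :=
  match u with
  | 0 => [0, 2]
  | 1 => [3, 2]
  | 2 => [1]
  | _ => [0, 1]

def W : ℕ → List ℕ
  | 0 => [0]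
  | n + 1 => (W n).flatMap phi

theorem phi_lt (u : ℕ) : ∀ a ∈ phi u, a < 4 := by
  unfold phi
  split <;> simp

theorem W_lt (n : ℕ) : ∀ a ∈ W n, a < 4 := by
  cases n with
  | zero => simp [W]
  | succ n =>
    intro a ha
    simp only [W, List.mem_flatMap] at ha
    obtain ⟨u, _, h⟩ := ha
    exact phi_lt u a h

def cnt (l : List ℕ) (i : ℕ) : ℤ := (l.count i : ℤ)

def Pos (n a : ℕ) (x : ℕ → ℤ) : Prop := ∃ p, (W n)[p]? = some a ∧ x = cnt ((W n).take p)

theorem parent (l : List ℕ) (hl : ∀ a ∈ l, a < 4) (p b : ℕ) (h : (l.flatMap phi)[p]? = some b) :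
    ∃ q a, l[q]? = some a ∧ ∃ r ∈ TR a, r.1 = b ∧
      cnt ((l.flatMap phi).take p) 0 = cnt (l.take q) 0 + cnt (l.take q) 3 + r.2.1 ∧
      cnt ((l.flatMap phi).take p) 1 = cnt (l.take q) 2 + cnt (l.take q) 3 ∧
      cnt ((l.flatMap phi).take p) 2 = cnt (l.take q) 0 + cnt (l.take q) 1 ∧
      cnt ((l.flatMap phi).take p) 3 = cnt (l.take q) 1 + r.2.2 := by
  induction l generalizing p with
  | nil => simp at h
  | cons a l ih =>
    have ha : a < 4 := hl a (by simp)
    have hl' : ∀ a ∈ l, a < 4 := fun x hx => hl x (by simp [hx])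
    rw [List.flatMap_cons] at h ⊢
    by_cases hp : p < (phi a).length
    · refine ⟨0, a, by simp, ?_⟩
      rw [List.getElem?_append_left hp] at h
      rw [List.take_append_of_le_length hp.le]
      interval_cases a <;> simp only [phi, List.length_cons, List.length_nil] at hp h ⊢ <;>
        interval_cases p <;> simp at h <;> subst h <;> simp [TR, cnt]
    · push Not at hp
      rw [List.getElem?_append_right hp] at h
      obtain ⟨q, a', hq, r, hr, hb, h0, h1, h2, h3⟩ := ih hl' _ h
      refine ⟨q + 1, a', by simpa using hq, r, hr, hb, ?_⟩
      rw [List.take_append, List.take_of_length_le hp, List.take_succ_cons]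
      simp only [cnt, List.count_append, List.count_cons] at h0 h1 h2 h3 ⊢
      push_cast
      rw [h0, h1, h2, h3]
      interval_cases a <;> simp [phi] <;> omega

theorem Pos_succ {n b : ℕ} {y : ℕ → ℤ} (h : Pos (n + 1) b y) :
    ∃ a x, Pos n a x ∧ ∃ r ∈ TR a, r.1 = b ∧
      y 0 = x 0 + x 3 + r.2.1 ∧ y 1 = x 2 + x 3 ∧ y 2 = x 0 + x 1 ∧ y 3 = x 1 + r.2.2 := by
  obtain ⟨p, hp, rfl⟩ := h
  obtain ⟨q, a, hq, h⟩ := parent (W n) (W_lt n) p b hp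
  exact ⟨a, _, ⟨q, hq, rfl⟩, h⟩

theorem Pos_zero {a : ℕ} {x : ℕ → ℤ} (h : Pos 0 a x) : a = 0 ∧ ∀ i, x i = 0 := by
  obtain ⟨p, hp, rfl⟩ := h
  rcases p with _ | p
  · simp [W] at hp
    subst hp
    simp [cnt]
  · simp [W] at hp

theorem cnt_sum (l : List ℕ) (hl : ∀ a ∈ l, a < 4) :
    cnt l 0 + cnt l 1 + cnt l 2 + cnt l 3 = l.length := by
  induction l with
  | nil => simp [cnt]
  | cons a l ih =>
    have ha : a < 4 := hl a (by simp)
    have := ih fun x hx => hl x (by simp [hx])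
    simp only [cnt, List.count_cons, List.length_cons] at this ⊢
    push_cast
    rw [← this]
    interval_cases a <;> simp <;> ring

theorem Pos_lt {n a : ℕ} {x : ℕ → ℤ} (h : Pos n a x) : a < 4 := by
  obtain ⟨p, hp, rfl⟩ := h
  exact W_lt n a (List.mem_of_getElem? hp)

theorem Pos_unique {n a a' : ℕ} {x x' : ℕ → ℤ} (h : Pos n a x) (h' : Pos n a' x')
    (e : ∀ i < 4, x i = x' i) : a = a' := by
  obtain ⟨p, hp, rfl⟩ := h
  obtain ⟨p', hpp, rfl⟩ := h'
  have h1 := cnt_sum ((W n).take p) fun a ha => W_lt n a (List.mem_of_mem_take ha)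
  have h2 := cnt_sum ((W n).take p') fun a ha => W_lt n a (List.mem_of_mem_take ha)
  rw [e 0 (by omega), e 1 (by omega), e 2 (by omega), e 3 (by omega), h2] at h1
  have l1 := (List.getElem?_eq_some_iff.1 hp).1
  have l2 := (List.getElem?_eq_some_iff.1 hpp).1
  simp only [List.length_take] at h1
  have : p = p' := by omega
  subst this
  rw [hp] at hpp
  exact Option.some.inj hpp

/-! ### Triples -/

/-- `Tri n u v w a b c d`: second difference `(a,b,c,d)` of three prefixes at level `n`. -/
def Tri (n u v w : ℕ) (a b c d : ℤ) : Prop :=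
  ∃ x y z, Pos n u x ∧ Pos n v y ∧ Pos n w z ∧ a = x 0 - 2 * y 0 + z 0 ∧
    b = x 1 - 2 * y 1 + z 1 ∧ c = x 2 - 2 * y 2 + z 2 ∧ d = x 3 - 2 * y 3 + z 3

theorem Tri_zero {u v w : ℕ} {a b c d : ℤ} (h : Tri 0 u v w a b c d) :
    u = 0 ∧ v = 0 ∧ w = 0 ∧ a = 0 ∧ b = 0 ∧ c = 0 ∧ d = 0 := by
  obtain ⟨x, y, z, hx, hy, hz, rfl, rfl, rfl, rfl⟩ := h
  obtain ⟨hu, hx⟩ := Pos_zero hx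
  obtain ⟨hv, hy⟩ := Pos_zero hy
  obtain ⟨hw, hz⟩ := Pos_zero hz
  simp [*]

theorem Tri_succ {n u v w : ℕ} {a b c d : ℤ} (h : Tri (n + 1) u v w a b c d) :
    ∃ u' v' w' a' b' c' d', Tri n u' v' w' a' b' c' d' ∧ ∃ x ∈ TR u', ∃ y ∈ TR v', ∃ z ∈ TR w',
      u = x.1 ∧ v = y.1 ∧ w = z.1 ∧
      a = a' + d' + (x.2.1 - 2 * y.2.1 + z.2.1) ∧ b = c' + d' ∧ c = a' + b' ∧
      d = b' + (x.2.2 - 2 * y.2.2 + z.2.2) := by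
  obtain ⟨x, y, z, hx, hy, hz, rfl, rfl, rfl, rfl⟩ := h
  obtain ⟨u', x', hx', rx, hrx, rfl, h10, h11, h12, h13⟩ := Pos_succ hx
  obtain ⟨v', y', hy', ry, hry, rfl, h20, h21, h22, h23⟩ := Pos_succ hy
  obtain ⟨w', z', hz', rz, hrz, rfl, h30, h31, h32, h33⟩ := Pos_succ hz
  refine ⟨u', v', w', _, _, _, _, ⟨x', y', z', hx', hy', hz', rfl, rfl, rfl, rfl⟩,
    rx, hrx, ry, hry, rz, hrz, rfl, rfl, rfl, ?_, ?_, ?_, ?_⟩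
  · rw [h10, h20, h30]; ring
  · rw [h11, h21, h31]; ring
  · rw [h12, h22, h32]; ring
  · rw [h13, h23, h33]; ring

theorem Tri_Q {n u v w : ℕ} {a b c d : ℤ} (h : Tri n u v w a b c d) : Q a b c d ≤ 640935 := by
  induction n generalizing u v w a b c d with
  | zero =>
    obtain ⟨-, -, -, rfl, rfl, rfl, rfl⟩ := Tri_zero h
    decide
  | succ n ih =>
    obtain ⟨u', v', w', a', b', c', d', h', x, hx, y, hy, z, hz, -, -, -, rfl, rfl, rfl, rfl⟩ :=
      Tri_succ h
    exact Q_step (DD_mem hx hy hz) (ih h')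

theorem S_back {a b c d p q : ℤ} (hpq : (p, q) ∈ DD) (hQ : Q a b c d ≤ 640935)
    (h : memS (a + d + p) (c + d) (a + b) (b + q) = true) : memS a b c d = true := by
  have h1 := memS_ch h
  simp only [chS, List.all_eq_true, force4_eq] at h1
  have h2 := h1 _ hpq
  simp only [chS1, sel_or, decide_eq_true_eq] at h2
  have e1 : a + b - (b + q - q) = a := by ring
  have e2 : b + q - q = b := by ring
  have e3 : -(a + d + p - p) + (c + d) + (a + b) - (b + q - q) = c := by ring
  have e4 : a + d + p - p - (a + b) + (b + q - q) = d := by ring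
  rw [e1, e3, e4, e2] at h2
  rcases h2 with h2 | h2
  · exact h2
  · omega

theorem Tri_F {n u v w : ℕ} {a b c d : ℤ} (h : Tri n u v w a b c d) (hS : memS a b c d = true) :
    mem3 treeF u v w a b c d = true := by
  induction n generalizing u v w a b c d with
  | zero =>
    obtain ⟨rfl, rfl, rfl, rfl, rfl, rfl, rfl⟩ := Tri_zero h
    decide +kernel
  | succ n ih =>
    obtain ⟨u', v', w', a', b', c', d', h', x, hx, y, hy, z, hz, rfl, rfl, rfl,
      rfl, rfl, rfl, rfl⟩ := Tri_succ h
    have h1 := memF_ch (ih h' (S_back (DD_mem hx hy hz) (Tri_Q h') hS))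
    simp only [chF, Bool.and_eq_true, List.all_eq_true, force4_eq] at h1
    have h2 := h1.2 x hx y hy z hz
    rw [chF1, sel_and, imp_iff] at h2
    exact h2.1 hS

theorem isK_iff (a b c d : ℤ) : isK a b c d = true ↔
    a + b + c + d = 0 ∧ b + 3 * c + 4 * d = 0 := by
  simp [isK]

theorem K_S {a b c d : ℤ} (hK : isK a b c d = true) (hQ : Q a b c d ≤ 640935) :
    memS a b c d = true := by
  rw [isK_iff] at hK
  obtain ⟨h1, h2⟩ := hK
  have ha : a = 2 * c + 3 * d := by omega
  have hb : b = -3 * c - 4 * d := by omega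
  subst ha hb
  have hq : Q (2 * c + 3 * d) (-3 * c - 4 * d) c d =
      108600 * (c * c) + 423710 * (c * d) + 461855 * (d * d) := by
    simp only [Q]
    ring
  rw [hq] at hQ
  have hc2 : c * c ≤ 100 := by nlinarith [sq_nonneg (461855 * d + 211855 * c)]
  have hd2 : d * d ≤ 100 := by nlinarith [sq_nonneg (108600 * c + 211855 * d)]
  have hc : -10 ≤ c ∧ c ≤ 10 := by constructor <;> nlinarith
  have hd : -10 ≤ d ∧ d ≤ 10 := by constructor <;> nlinarith
  rw [← hq] at hQ
  have h3 := allK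
  simp only [checkK, List.all_eq_true, List.mem_range, force4_eq] at h3
  have h4 := h3 (c + 10).toNat (by omega) (d + 10).toNat (by omega)
  have e1 : Int.ofNat (c + 10).toNat - 10 = c := by simp only [Int.ofNat_eq_natCast]; omega
  have e2 : Int.ofNat (d + 10).toNat - 10 = d := by simp only [Int.ofNat_eq_natCast]; omega
  rw [e1, e2, chS1, sel_or, decide_eq_true_eq] at h4
  rcases h4 with h4 | h4
  · exact h4
  · omega

theorem Tri_K {n u v w : ℕ} {a b c d : ℤ} (h : Tri n u v w a b c d) (hK : isK a b c d = true) :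
    mem3 treeG u v w a b c d = true := by
  have h1 := memF_ch (Tri_F h (K_S hK (Tri_Q h)))
  simp only [chF, Bool.and_eq_true, imp_iff] at h1
  exact h1.1 hK

theorem G_back {n u v w : ℕ} {a b c d : ℤ} (h : Tri n u v w a b c d) {x y z : ℕ × ℤ × ℤ}
    (hx : x ∈ TR u) (hy : y ∈ TR v) (hz : z ∈ TR w)
    (hG : mem3 treeG x.1 y.1 z.1 (a + d + (x.2.1 - 2 * y.2.1 + z.2.1)) (c + d) (a + b)
      (b + (x.2.2 - 2 * y.2.2 + z.2.2)) = true) : mem3 treeG u v w a b c d = true := by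
  have h1 := memF_ch (Tri_F h (S_back (DD_mem hx hy hz) (Tri_Q h) (memG_S hG)))
  simp only [chF, Bool.and_eq_true, List.all_eq_true, force4_eq] at h1
  have h2 := h1.2 x hx y hy z hz
  rw [chF1, sel_and, imp_iff, imp_iff] at h2
  exact h2.2 hG

/-! ### Quadruples -/

theorem quad (n : ℕ) {u v w t : ℕ} {x y z s : ℕ → ℤ}
    (hx : Pos n u x) (hy : Pos n v y) (hz : Pos n w z) (hs : Pos n t s)
    (hne : ¬ ∀ i < 4, x i = y i ∧ y i = z i ∧ z i = s i)
    (h1 : mem3 treeG u v w (x 0 - 2 * y 0 + z 0) (x 1 - 2 * y 1 + z 1) (x 2 - 2 * y 2 + z 2)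
      (x 3 - 2 * y 3 + z 3) = true)
    (h2 : mem3 treeG v w t (y 0 - 2 * z 0 + s 0) (y 1 - 2 * z 1 + s 1) (y 2 - 2 * z 2 + s 2)
      (y 3 - 2 * z 3 + s 3) = true) :
    memH u v w t (x 0 - 2 * y 0 + z 0) (x 1 - 2 * y 1 + z 1) (x 2 - 2 * y 2 + z 2)
      (x 3 - 2 * y 3 + z 3) (y 0 - 2 * z 0 + s 0) (y 1 - 2 * z 1 + s 1) (y 2 - 2 * z 2 + s 2)
      (y 3 - 2 * z 3 + s 3) = true := by
  induction n generalizing u v w t x y z s with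
  | zero =>
    exfalso
    apply hne
    intro i _
    simp [(Pos_zero hx).2, (Pos_zero hy).2, (Pos_zero hz).2, (Pos_zero hs).2]
  | succ n ih =>
    obtain ⟨u', x', hx', rx, hrx, rfl, h10, h11, h12, h13⟩ := Pos_succ hx
    obtain ⟨v', y', hy', ry, hry, rfl, h20, h21, h22, h23⟩ := Pos_succ hy
    obtain ⟨w', z', hz', rz, hrz, rfl, h30, h31, h32, h33⟩ := Pos_succ hz
    obtain ⟨t', s', hs', rs, hrs, rfl, h40, h41, h42, h43⟩ := Pos_succ hs
    have a0 : x 0 - 2 * y 0 + z 0 = (x' 0 - 2 * y' 0 + z' 0) + (x' 3 - 2 * y' 3 + z' 3) +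
        (rx.2.1 - 2 * ry.2.1 + rz.2.1) := by rw [h10, h20, h30]; ring
    have a1 : x 1 - 2 * y 1 + z 1 = (x' 2 - 2 * y' 2 + z' 2) + (x' 3 - 2 * y' 3 + z' 3) := by
      rw [h11, h21, h31]; ring
    have a2 : x 2 - 2 * y 2 + z 2 = (x' 0 - 2 * y' 0 + z' 0) + (x' 1 - 2 * y' 1 + z' 1) := by
      rw [h12, h22, h32]; ring
    have a3 : x 3 - 2 * y 3 + z 3 = (x' 1 - 2 * y' 1 + z' 1) +
        (rx.2.2 - 2 * ry.2.2 + rz.2.2) := by rw [h13, h23, h33]; ring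
    have b0 : y 0 - 2 * z 0 + s 0 = (y' 0 - 2 * z' 0 + s' 0) + (y' 3 - 2 * z' 3 + s' 3) +
        (ry.2.1 - 2 * rz.2.1 + rs.2.1) := by rw [h20, h30, h40]; ring
    have b1 : y 1 - 2 * z 1 + s 1 = (y' 2 - 2 * z' 2 + s' 2) + (y' 3 - 2 * z' 3 + s' 3) := by
      rw [h21, h31, h41]; ring
    have b2 : y 2 - 2 * z 2 + s 2 = (y' 0 - 2 * z' 0 + s' 0) + (y' 1 - 2 * z' 1 + s' 1) := by
      rw [h22, h32, h42]; ring
    have b3 : y 3 - 2 * z 3 + s 3 = (y' 1 - 2 * z' 1 + s' 1) +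
        (ry.2.2 - 2 * rz.2.2 + rs.2.2) := by rw [h23, h33, h43]; ring
    rw [a0, a1, a2, a3] at h1 ⊢
    rw [b0, b1, b2, b3] at h2 ⊢
    by_cases hall : ∀ i < 4, x' i = y' i ∧ y' i = z' i ∧ z' i = s' i
    · have e1 : u' = v' := Pos_unique hx' hy' fun i hi => (hall i hi).1
      have e2 : v' = w' := Pos_unique hy' hz' fun i hi => (hall i hi).2.1
      have e3 : w' = t' := Pos_unique hz' hs' fun i hi => (hall i hi).2.2
      subst e1 e2 e3
      have hu := Pos_lt hx'
      have hsd := allSeeds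
      simp only [checkSeeds, List.all_eq_true, Bool.or_eq_true, Bool.and_eq_true,
        decide_eq_true_eq] at hsd
      have hu' : u' ∈ [0, 1, 2, 3] := by
        interval_cases u' <;> simp
      have z0 := hall 0 (by omega)
      have z1 := hall 1 (by omega)
      have z2 := hall 2 (by omega)
      have z3 := hall 3 (by omega)
      rcases hsd u' hu' rx hrx ry hry rz hrz rs hrs with hc | hc
      · exfalso
        apply hne
        obtain ⟨c1, c2, c3⟩ := hc
        intro i hi
        interval_cases i
        · rw [h10, h20, h30, h40, c1, c2, c3, z0.1, z0.2.1, z0.2.2, z3.1, z3.2.1, z3.2.2]; simp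
        · rw [h11, h21, h31, h41, z2.1, z2.2.1, z2.2.2, z3.1, z3.2.1, z3.2.2]; simp
        · rw [h12, h22, h32, h42, z0.1, z0.2.1, z0.2.2, z1.1, z1.2.1, z1.2.2]; simp
        · rw [h13, h23, h33, h43, c1, c2, c3, z1.1, z1.2.1, z1.2.2]; simp
      · simp only [chH1, force4_eq, chH0, imp_iff] at hc
        have k0 : ∀ i < 4, x' i - 2 * y' i + z' i = 0 := fun i hi => by
          obtain ⟨q1, q2, q3⟩ := hall i hi
          omega
        have k1 : ∀ i < 4, y' i - 2 * z' i + s' i = 0 := fun i hi => by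
          obtain ⟨q1, q2, q3⟩ := hall i hi
          omega
        rw [k0 0 (by omega), k0 1 (by omega), k0 2 (by omega), k0 3 (by omega)] at h1 ⊢
        rw [k1 0 (by omega), k1 1 (by omega), k1 2 (by omega), k1 3 (by omega)] at h2 ⊢
        exact hc h1 h2
    · have g1 := G_back ⟨x', y', z', hx', hy', hz', rfl, rfl, rfl, rfl⟩ hrx hry hrz h1
      have g2 := G_back ⟨y', z', s', hy', hz', hs', rfl, rfl, rfl, rfl⟩ hry hrz hrs h2
      have hH := memH_ch (ih hx' hy' hz' hs' hall g1 g2)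
      simp only [chH, Bool.and_eq_true, List.all_eq_true] at hH
      have hc := hH.2 rx hrx ry hry rz hrz rs hrs
      simp only [chH1, force4_eq, chH0, imp_iff] at hc
      exact hc h1 h2

theorem no_cube (n : ℕ) {u v w t : ℕ} {x y z s : ℕ → ℤ}
    (hx : Pos n u x) (hy : Pos n v y) (hz : Pos n w z) (hs : Pos n t s)
    (hne : ¬ ∀ i < 4, x i = y i ∧ y i = z i ∧ z i = s i)
    (h1 : isK (x 0 - 2 * y 0 + z 0) (x 1 - 2 * y 1 + z 1) (x 2 - 2 * y 2 + z 2)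
      (x 3 - 2 * y 3 + z 3) = true)
    (h2 : isK (y 0 - 2 * z 0 + s 0) (y 1 - 2 * z 1 + s 1) (y 2 - 2 * z 2 + s 2)
      (y 3 - 2 * z 3 + s 3) = true) : False := by
  have g1 := Tri_K ⟨x, y, z, hx, hy, hz, rfl, rfl, rfl, rfl⟩ h1
  have g2 := Tri_K ⟨y, z, s, hy, hz, hs, rfl, rfl, rfl, rfl⟩ h2
  have hH := memH_ch (quad n hx hy hz hs hne g1 g2)
  simp only [chH, Bool.and_eq_true, imp_iff] at hH
  have := hH.1 h1
  rw [h2] at this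
  exact absurd this (by simp)

/-! ### The infinite word -/

theorem W_append (n : ℕ) : ∃ s, s ≠ [] ∧ W (n + 1) = W n ++ s := by
  induction n with
  | zero => exact ⟨[2], by simp, rfl⟩
  | succ n ih =>
    obtain ⟨s, hs, h⟩ := ih
    refine ⟨s.flatMap phi, ?_, ?_⟩
    · intro h0
      rw [List.flatMap_eq_nil_iff] at h0
      obtain ⟨x, hx⟩ := List.exists_mem_of_ne_nil s hs
      have := h0 x hx
      unfold phi at this
      split at this <;> simp at this
    · rw [W, h, List.flatMap_append, ← h]
      rfl

theorem W_length (n : ℕ) : n < (W n).length := by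
  induction n with
  | zero => simp [W]
  | succ n ih =>
    obtain ⟨s, hs, h⟩ := W_append n
    have := List.length_pos_of_ne_nil hs
    rw [h, List.length_append]
    omega

theorem W_prefix {m n : ℕ} (h : m ≤ n) : W m <+: W n := by
  induction n, h using Nat.le_induction with
  | base => exact List.prefix_rfl
  | succ n _ ih =>
    obtain ⟨s, _, h⟩ := W_append n
    exact ih.trans ⟨s, h.symm⟩

def val (u : ℕ) : ℕ :=
  match u with
  | 0 => 0
  | 1 => 1
  | 2 => 3
  | _ => 4

def word (i : ℕ) : ℕ := val ((W i).getD i 0)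

theorem word_eq {N p : ℕ} (h : p ≤ N) : ∃ a, (W N)[p]? = some a ∧ word p = val a := by
  have hp := W_length p
  refine ⟨(W p)[p], ?_, ?_⟩
  · obtain ⟨s, hs⟩ := W_prefix h
    rw [← hs, List.getElem?_append_left hp, List.getElem?_eq_getElem hp]
  · simp [word, List.getD, hp]

/-- Weight of the prefix of length `p`. -/
def wt (N p : ℕ) : ℤ :=
  cnt ((W N).take p) 1 + 3 * cnt ((W N).take p) 2 + 4 * cnt ((W N).take p) 3

theorem wt_succ {N p : ℕ} (h : p ≤ N) : wt N (p + 1) = wt N p + word p := by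
  obtain ⟨a, ha, hw⟩ := word_eq h
  have hlt := W_lt N a (List.mem_of_getElem? ha)
  rw [hw, wt, wt, List.take_add_one, ha]
  simp only [cnt, List.count_append, Option.toList_some]
  push_cast
  interval_cases a <;> simp [val] <;> ring

theorem wt_sum {N i m : ℕ} (h : i + m ≤ N + 1) :
    ((∑ j ∈ Finset.range m, word (i + j) : ℕ) : ℤ) = wt N (i + m) - wt N i := by
  induction m with
  | zero => simp
  | succ m ih =>
    rw [Finset.sum_range_succ, Nat.cast_add, ih (by omega), ← add_assoc, wt_succ (by omega)]
    ring

theorem len_take {N p : ℕ} (h : p ≤ N) : cnt ((W N).take p) 0 + cnt ((W N).take p) 1 +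
    cnt ((W N).take p) 2 + cnt ((W N).take p) 3 = p := by
  rw [cnt_sum _ fun a ha => W_lt N a (List.mem_of_mem_take ha), List.length_take]
  have := W_length N
  congr 1
  omega

end AddCube

/-- There exists an infinite word over the alphabet `{0,1,3,4}`
containing no additive cube. -/
theorem exists_infinite_word_avoiding_additive_cubes :
    ∃ f : ℕ → ℕ, (∀ n, f n ∈ ({0, 1, 3, 4} : Set ℕ)) ∧
      ∀ (i n : ℕ), 1 ≤ n →
        ¬ ((∑ j ∈ Finset.range n, f (i + j) = ∑ j ∈ Finset.range n, f (i + n + j)) ∧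
           (∑ j ∈ Finset.range n, f (i + n + j) = ∑ j ∈ Finset.range n, f (i + 2 * n + j))) := by
  refine ⟨AddCube.word, ?_, ?_⟩
  · intro n
    unfold AddCube.word AddCube.val
    split <;> simp
  · rintro i n hn ⟨h1, h2⟩
    have s0 := AddCube.wt_sum (N := i + 3 * n) (i := i) (m := n) (by omega)
    have s1 := AddCube.wt_sum (N := i + 3 * n) (i := i + n) (m := n) (by omega)
    have s2 := AddCube.wt_sum (N := i + 3 * n) (i := i + 2 * n) (m := n) (by omega)
    rw [h1, s1] at s0
    rw [← h2, s1] at s2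
    rw [show i + n + n = i + 2 * n by ring] at s0 s2
    rw [show i + 2 * n + n = i + 3 * n by ring] at s2
    obtain ⟨a0, p0, -⟩ := AddCube.word_eq (N := i + 3 * n) (p := i) (by omega)
    obtain ⟨a1, p1, -⟩ := AddCube.word_eq (N := i + 3 * n) (p := i + n) (by omega)
    obtain ⟨a2, p2, -⟩ := AddCube.word_eq (N := i + 3 * n) (p := i + 2 * n) (by omega)
    obtain ⟨a3, p3, -⟩ := AddCube.word_eq (N := i + 3 * n) (p := i + 3 * n) (by omega)
    have l0 := AddCube.len_take (N := i + 3 * n) (p := i) (by omega)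
    have l1 := AddCube.len_take (N := i + 3 * n) (p := i + n) (by omega)
    have l2 := AddCube.len_take (N := i + 3 * n) (p := i + 2 * n) (by omega)
    have l3 := AddCube.len_take (N := i + 3 * n) (p := i + 3 * n) (by omega)
    simp only [AddCube.wt] at s0 s2
    push_cast at l0 l1 l2 l3
    refine AddCube.no_cube (i + 3 * n) ⟨_, p0, rfl⟩ ⟨_, p1, rfl⟩ ⟨_, p2, rfl⟩ ⟨_, p3, rfl⟩ ?_ ?_ ?_
    · intro hall
      have e0 := (hall 0 (by omega)).1
      have e1 := (hall 1 (by omega)).1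
      have e2 := (hall 2 (by omega)).1
      have e3 := (hall 3 (by omega)).1
      omega
    · rw [AddCube.isK_iff]
      constructor <;> omega
    · rw [AddCube.isK_iff]
      constructor <;> omega
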